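/- Let G be a free group of finite rank r > 1 with free generating set S, acting on a standard Borel probability space (X, μ) by μ-preserving Borel automorphisms. Suppose f_G(X, μ) is defined, the action is ergodic, and f_G(X, μ) ≠ −∞. Then there is n ∈ ℕ such that for every subgroup Γ ≤ G which contains a non-trivial normal subgroup of G, the restricted action of Γ on (X, μ) has at most n ergodic components; concretely, every family of pairwise disjoint Borel subsets of X, each of positive μ-measure and each essentially Γ-invariant (μ(γ·B Δ B) = 0 for all γ ∈ Γ), has at most n members. -/

import Mathlib

open MeasureTheory Filter Set
open scoped ENNReal symmDiff Pointwise

namespace FPaper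

/-- The free group of rank `r`; its free generating set `S` is `{FreeGroup.of i | i : Fin r}`. -/
abbrev FG (r : ℕ) := FreeGroup (Fin r)

/-- The reduced `S`-word length of a group element. -/
def wlen {r : ℕ} (g : FG r) : ℕ := g.toWord.length

/-- The ball of radius `n` in `FG r` with respect to the word length. -/
def ball (r n : ℕ) : Set (FG r) := {g | wlen g ≤ n}

instance ballFinite (r n : ℕ) : Finite (ball r n) := by
  have h : ball r n ⊆ FreeGroup.mk '' {l : List (Fin r × Bool) | l.length ≤ n} :=
    fun g hg => ⟨g.toWord, hg, FreeGroup.mk_toWord⟩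
  exact (((List.finite_length_le _ n).image _).subset h).to_subtype

/-- An action of a group `G` on a measurable space `X` by Borel automorphisms. -/
structure BorelAction (G : Type*) [Group G] (X : Type*) [MeasurableSpace X] where
  act : G → X → X
  act_one : ∀ x, act 1 x = x
  act_mul : ∀ g h x, act (g * h) x = act g (act h x)
  measurable_act : ∀ g, Measurable (act g)

namespace BorelAction

variable {G X : Type*} [Group G] [mX : MeasurableSpace X]

/-- The action preserves the measure `μ`. -/
def Preserves (T : BorelAction G X) (μ : Measure X) : Prop :=
  ∀ g : G, MeasurePreserving (T.act g) μ μ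

/-- The translated set `g · B`. -/
def smulSet (T : BorelAction G X) (g : G) (B : Set X) : Set X := T.act g⁻¹ ⁻¹' B

/-- The translated partition `g · α`, where a countable measurable partition is recorded
by a (measurable, countably-valued) function whose fibers are the cells. -/
def tr {I : Type*} (T : BorelAction G X) (g : G) (a : X → I) : X → I :=
  fun x => a (T.act g⁻¹ x)

/-- The join `F · α = ⋁_{f ∈ F} f · α` of the translates of a partition over a set `F ⊆ G`. -/
def joinF {I : Type*} (T : BorelAction G X) (F : Set G) (a : X → I) : X → (F → I) :=
  fun x f => a (T.act (f : G)⁻¹ x)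

/-- The σ-algebra generated by the partitions `f · α`, `f ∈ F`. -/
def partSA {I : Type*} (T : BorelAction G X) (F : Set G) (a : X → I) : MeasurableSpace X :=
  ⨆ f ∈ F, MeasurableSpace.comap (T.tr f a) ⊤

/-- The partition `a` is generating: the smallest `G`-invariant σ-algebra containing `a`
(i.e. the one generated by all translates of `a`) contains every measurable set up to
`ν`-null sets. -/
def Generating {I : Type*} (T : BorelAction G X) (a : X → I) (ν : Measure X) : Prop :=
  ∀ B : Set X, MeasurableSet B →
    ∃ B', MeasurableSet[T.partSA Set.univ a] B' ∧ ν (B ∆ B') = 0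


/-- Ergodicity of the action with respect to `ν`. -/
def IsErgodic (T : BorelAction G X) (ν : Measure X) : Prop :=
  ∀ B : Set X, MeasurableSet B → (∀ g : G, ν (T.smulSet g B ∆ B) = 0) → ν B = 0 ∨ ν B = 1

/-- The action is essentially free with respect to `ν`. -/
def EssentiallyFree (T : BorelAction G X) (ν : Measure X) : Prop :=
  ν {x | ∀ g : G, g ≠ 1 → T.act g x ≠ x} = 1

/-- The stabilizer subgroup of a point. -/
def stab (T : BorelAction G X) (y : X) : Subgroup G where
  carrier := {g | T.act g y = y}
  one_mem' := T.act_one y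
  mul_mem' := by
    intro g h hg hh
    simp only [Set.mem_setOf_eq] at *
    rw [T.act_mul, hh, hg]
  inv_mem' := by
    intro g hg
    simp only [Set.mem_setOf_eq] at *
    conv_lhs => rw [← hg]
    rw [← T.act_mul, inv_mul_cancel, T.act_one]

end BorelAction

/-- `m` is a `G`-invariant sub-σ-algebra. -/
def InvariantSA {G X : Type*} [Group G] (m : MeasurableSpace X) [mX : MeasurableSpace X]
    (T : BorelAction G X) : Prop :=
  m ≤ mX ∧ ∀ (g : G) (B : Set X), MeasurableSet[m] B → MeasurableSet[m] (T.act g ⁻¹' B)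

/-- A measure is purely atomic: the set of atoms has full measure. -/
def PurelyAtomic {X : Type*} [MeasurableSpace X] (ν : Measure X) : Prop :=
  ν {x | 0 < ν {x}} = 1

/-- Shannon entropy of a countable measurable partition (recorded as a countably-valued
function), with values in `[0, ∞]`. -/
noncomputable def Hpart {X I : Type*} [MeasurableSpace X] [Countable I]
    (μ : Measure X) (a : X → I) : ℝ≥0∞ :=
  ∑' i : I, ENNReal.ofReal (Real.negMulLog (μ (a ⁻¹' {i})).toReal)

/-- Conditional Shannon entropy of a countable partition given a sub-σ-algebra `m`:
`H(α/m) = ∫ ∑_{A ∈ α} φ(E[1_A | m](x)) dμ(x)` with `φ(t) = -t log t`. -/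
noncomputable def condEntS {X I : Type*} (m : MeasurableSpace X) [mX : MeasurableSpace X]
    [Countable I] (μ : Measure X) (a : X → I) : ℝ≥0∞ :=
  ∫⁻ x, ∑' i : I,
    ENNReal.ofReal (Real.negMulLog ((μ[(a ⁻¹' {i}).indicator (fun _ => (1:ℝ)) | m]) x)) ∂μ

/-- Conditional Shannon entropy of a partition given another partition:
`H(α/β) = ∑_{B ∈ β} ∑_{A ∈ α} -μ(B) · (μ(A∩B)/μ(B)) · log (μ(A∩B)/μ(B))`
(equivalently `H(α ∨ β) − H(β)`), with values in `[0, ∞]`. -/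
noncomputable def condEntP {X I J : Type*} [MeasurableSpace X] [Countable I] [Countable J]
    (μ : Measure X) (a : X → I) (b : X → J) : ℝ≥0∞ :=
  ∑' q : I × J, μ (b ⁻¹' {q.2}) *
    ENNReal.ofReal (Real.negMulLog
      ((μ (a ⁻¹' {q.1} ∩ b ⁻¹' {q.2})).toReal / (μ (b ⁻¹' {q.2})).toReal))

/-- `F_G(X, μ, S, β) = (1-2r)·H(β) + ∑_{s ∈ S} H(s·β ∨ β)`. -/
noncomputable def FF {r : ℕ} {X I : Type*} [MeasurableSpace X] [Countable I]
    (μ : Measure X) (T : BorelAction (FG r) X) (b : X → I) : ℝ :=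
  (1 - 2 * (r : ℝ)) * (Hpart μ b).toReal
    + ∑ i : Fin r, (Hpart μ (fun x => (T.tr (FreeGroup.of i) b x, b x))).toReal

/-- The sequence `n ↦ F_G(X, μ, S, B_n · α)`. -/
noncomputable def fSeq {r : ℕ} {X : Type*} [MeasurableSpace X]
    (μ : Measure X) (T : BorelAction (FG r) X) (a : X → ℕ) (n : ℕ) : ℝ :=
  FF μ T (T.joinF (ball r n) a)

/-- The f-invariant entropy `f_G(X, μ) = lim_n F_G(X, μ, S, B_n·α)`, the limit (= infimum,
since the sequence is non-increasing) of the sequence `fSeq`, with values in `[-∞, ∞)`. -/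
noncomputable def fInv {r : ℕ} {X : Type*} [MeasurableSpace X]
    (μ : Measure X) (T : BorelAction (FG r) X) (a : X → ℕ) : EReal :=
  ⨅ n : ℕ, ((fSeq μ T a n : ℝ) : EReal)

/-- Relative version `F_G(X, μ/Σ, S, β) = (1-2r)·H(β/Σ) + ∑_{s ∈ S} H(s·β ∨ β / Σ)`. -/
noncomputable def FFrel {r : ℕ} {X I : Type*} (m : MeasurableSpace X) [mX : MeasurableSpace X]
    [Countable I] (μ : Measure X) (T : BorelAction (FG r) X) (b : X → I) : ℝ :=
  (1 - 2 * (r : ℝ)) * (condEntS m μ b).toReal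
    + ∑ i : Fin r, (condEntS m μ (fun x => (T.tr (FreeGroup.of i) b x, b x))).toReal

/-- The sequence `n ↦ F_G(X, μ/Σ, S, B_n · α)`. -/
noncomputable def fSeqRel {r : ℕ} {X : Type*} (m : MeasurableSpace X) [mX : MeasurableSpace X]
    (μ : Measure X) (T : BorelAction (FG r) X) (a : X → ℕ) (n : ℕ) : ℝ :=
  FFrel m μ T (T.joinF (ball r n) a)

/-- The relative f-invariant entropy `f_G(X, μ/Σ)`, with values in `[-∞, ∞)`. -/
noncomputable def fInvRel {r : ℕ} {X : Type*} (m : MeasurableSpace X) [mX : MeasurableSpace X]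
    (μ : Measure X) (T : BorelAction (FG r) X) (a : X → ℕ) : EReal :=
  ⨅ n : ℕ, ((fSeqRel m μ T a n : ℝ) : EReal)

/-- A total order on `S ∪ S⁻¹` is recorded by an injection `ord : Fin r × Bool → ℕ`;
`g ≺ h` iff `|g| < |h|`, or `|g| = |h|` and the reduced word of `g` lexicographically
precedes that of `h`. -/
def wlt {r : ℕ} (ord : Fin r × Bool → ℕ) (g h : FG r) : Prop :=
  wlen g < wlen h ∨ (wlen g = wlen h ∧ List.Lex (fun p q => ord p < ord q) g.toWord h.toWord)

/-- `Pre(g)`: the set of elements strictly preceding `g`. -/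
def Pre {r : ℕ} (ord : Fin r × Bool → ℕ) (g : FG r) : Set (FG r) := {h | wlt ord h g}

/-- The generator or inverse generator corresponding to a letter. -/
def letter {r : ℕ} (p : Fin r × Bool) : FG r :=
  if p.2 then FreeGroup.of p.1 else (FreeGroup.of p.1)⁻¹

/-- The first (leftmost) letter of the reduced word of `g` (junk value `1` for `g = 1`). -/
def firstLetter {r : ℕ} (g : FG r) : FG r := ((g.toWord.head?).map letter).getD 1

/-- The independence decay `δ(g, α/Σ)`, as a real number:
`δ(g, α/Σ) = H(s⁻¹g·α / Pre(s⁻¹g)·α ∨ Σ) − H(g·α / Pre(g)·α ∨ Σ)` where `s` is the first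
letter of `g`. -/
noncomputable def idecay {r : ℕ} {X I : Type*} (m : MeasurableSpace X) [mX : MeasurableSpace X]
    [Countable I] (μ : Measure X) (T : BorelAction (FG r) X)
    (ord : Fin r × Bool → ℕ) (a : X → I) (g : FG r) : ℝ :=
  (condEntS (m ⊔ T.partSA (Pre ord ((firstLetter g)⁻¹ * g)) a) μ
      (T.tr ((firstLetter g)⁻¹ * g) a)).toReal
  - (condEntS (m ⊔ T.partSA (Pre ord g) a) μ (T.tr g a)).toReal

/-- The entropy `H(τ)` of a probability space: the supremum of the Shannon entropies of
finite measurable partitions. -/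
noncomputable def measEnt {M : Type*} [MeasurableSpace M] (τ : Measure M) : ℝ≥0∞ :=
  ⨆ (P : Finset (Set M)) (_ : ∀ p ∈ P, MeasurableSet p)
    (_ : (P : Set (Set M)).PairwiseDisjoint id) (_ : ⋃₀ (P : Set (Set M)) = Set.univ),
    ∑ p ∈ P, ENNReal.ofReal (Real.negMulLog (τ p).toReal)

/-- The non-negative part of an extended real, in `ℝ≥0∞`. -/
noncomputable def erealToENNReal (x : EReal) : ℝ≥0∞ :=
  if x = ⊤ then ⊤ else ENNReal.ofReal x.toReal

/-- The integral of an `EReal`-valued function (positive part minus negative part),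
with values in `[-∞, ∞]`. -/
noncomputable def eIntegral {M : Type*} [MeasurableSpace M] (τ : Measure M) (f : M → EReal) :
    EReal :=
  ((∫⁻ m, erealToENNReal (f m) ∂τ : ℝ≥0∞) : EReal)
    - ((∫⁻ m, erealToENNReal (-(f m)) ∂τ : ℝ≥0∞) : EReal)

/-- The set of `G`-invariant Borel probability measures on `X`. -/
def InvProb {G X : Type*} [Group G] [MeasurableSpace X] (T : BorelAction G X) :
    Set (Measure X) :=
  {ν | IsProbabilityMeasure ν ∧ ∀ g : G, MeasurePreserving (T.act g) ν ν}

/-! ### Invariant submodular functions on a lattice with a group action -/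

/-- A monotone submodular function on a lattice, invariant under an action of the group `G`
that is compatible with joins. -/
structure IsInvSubmod (G : Type*) [Group G] {Λ : Type*} [Lattice Λ] [MulAction G Λ]
    (h : Λ → ℝ) : Prop where
  mono : Monotone h
  submod : ∀ A B, h (A ⊔ B) + h (A ⊓ B) ≤ h A + h B
  smul_sup : ∀ (g : G) (A B : Λ), g • (A ⊔ B) = g • A ⊔ g • B
  inv : ∀ (g : G) (A : Λ), h (g • A) = h A

namespace IsInvSubmod

variable {G Λ : Type*} [Group G] [Lattice Λ] [MulAction G Λ] {h : Λ → ℝ}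

lemma smul_le_smul (hh : IsInvSubmod G h) (g : G) {A B : Λ} (hAB : A ≤ B) : g • A ≤ g • B := by
  have := hh.smul_sup g A B
  rw [sup_eq_right.2 hAB] at this
  rw [this]
  exact le_sup_left

lemma cond_le (hh : IsInvSubmod G h) {U W : Λ} (hUW : U ≤ W) (V : Λ) :
    h (W ⊔ V) - h W ≤ h (U ⊔ V) - h U := by
  have h1 := hh.submod W (U ⊔ V)
  have h2 : h U ≤ h (W ⊓ (U ⊔ V)) := hh.mono (le_inf hUW le_sup_left)
  rw [← sup_assoc, sup_eq_left.2 hUW] at h1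
  linarith

lemma smul_sup_smul (hh : IsInvSubmod G h) (g : G) (A B : Λ) :
    h (g • A ⊔ g • B) = h (A ⊔ B) := by
  rw [← hh.smul_sup, hh.inv]

end IsInvSubmod

/-- The functional `F` attached to a function on a lattice carrying an action of the free group. -/
noncomputable def latticeF (r : ℕ) {Λ : Type*} [Lattice Λ] [MulAction (FG r) Λ]
    (h : Λ → ℝ) (A : Λ) : ℝ :=
  (1 - 2 * (r : ℝ)) * h A + ∑ i : Fin r, h ((FreeGroup.of i : FG r) • A ⊔ A)

lemma letter_true {r : ℕ} (i : Fin r) : letter (i, true) = (FreeGroup.of i : FG r) := by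
  simp [letter]

lemma letter_false {r : ℕ} (i : Fin r) : letter (i, false) = (FreeGroup.of i : FG r)⁻¹ := by
  simp [letter]

lemma mk_singleton_eq_letter {r : ℕ} (p : Fin r × Bool) : FreeGroup.mk [p] = letter p := by
  obtain ⟨i, b⟩ := p
  cases b
  · rw [letter_false]; rfl
  · rw [letter_true]; rfl

/-- A simple splitting does not increase `F`. -/
lemma latticeF_splitting_le {r : ℕ} {Λ : Type*} [Lattice Λ] [MulAction (FG r) Λ] {h : Λ → ℝ}
    (hh : IsInvSubmod (FG r) h) (p : Fin r × Bool) {A W : Λ} (hAW : A ≤ W) :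
    latticeF r h (W ⊔ letter p • A) ≤ latticeF r h W := by
  set t : FG r := letter p with ht
  set D : ℝ := h (W ⊔ t • A) - h W with hD
  have hcond : ∀ (s : FG r) (V : Λ), s • W ≤ V → h (V ⊔ s • t • A) - h V ≤ D := by
    intro s V hV
    refine (hh.cond_le hV _).trans ?_
    rw [hh.smul_sup_smul, hh.inv]
  have hcond1 : ∀ V : Λ, W ≤ V → h (V ⊔ t • A) - h V ≤ D := fun V hV => hh.cond_le hV _
  have key : ∀ i : Fin r, h ((FreeGroup.of i : FG r) • (W ⊔ t • A) ⊔ (W ⊔ t • A))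
      ≤ h ((FreeGroup.of i : FG r) • W ⊔ W) + (2 * D - if i = p.1 then D else 0) := by
    intro i
    set s : FG r := FreeGroup.of i with hs
    have hsplit : s • (W ⊔ t • A) ⊔ (W ⊔ t • A) = ((s • W ⊔ W) ⊔ t • A) ⊔ s • t • A := by
      rw [hh.smul_sup]
      ac_rfl
    rw [hsplit]
    have h1 := hcond1 (s • W ⊔ W) le_sup_right
    have h2 := hcond s ((s • W ⊔ W) ⊔ t • A) (le_sup_left.trans le_sup_left)
    split_ifs with hi
    · obtain ⟨j, b⟩ := p
      subst hi
      cases b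
      · have : s • t • A ≤ (s • W ⊔ W) ⊔ t • A := by
          rw [ht, letter_false, ← hs, smul_inv_smul]
          exact hAW.trans (le_sup_right.trans le_sup_left)
        rw [sup_eq_left.2 this]
        linarith
      · have : t • A ≤ s • W ⊔ W := by
          rw [ht, letter_true, ← hs]
          exact (hh.smul_le_smul s hAW).trans le_sup_left
        rw [sup_eq_left.2 this] at h2 ⊢
        linarith
    · linarith
  have hsum := Finset.sum_le_sum fun i (_ : i ∈ Finset.univ) => key i
  rw [Finset.sum_add_distrib, Finset.sum_sub_distrib] at hsum
  simp only [Finset.sum_const, Finset.card_univ, Fintype.card_fin, nsmul_eq_mul,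
    Finset.sum_ite_eq', Finset.mem_univ, if_true] at hsum
  unfold latticeF
  have : h (W ⊔ t • A) = h W + D := by rw [hD]; ring
  rw [this]
  linarith

/-! ### Balls in the free group -/

/-- The ball of radius `n` as a `Finset`. -/
noncomputable def ballFin (r n : ℕ) : Finset (FG r) := (Set.toFinite (ball r n)).toFinset

@[simp]
lemma mem_ballFin {r n : ℕ} {g : FG r} : g ∈ ballFin r n ↔ wlen g ≤ n := by
  simp [ballFin, ball]

lemma wlen_mul_le {r : ℕ} (g g' : FG r) : wlen (g * g') ≤ wlen g + wlen g' :=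
  FreeGroup.norm_mul_le g g'

lemma wlen_inv {r : ℕ} (g : FG r) : wlen g⁻¹ = wlen g := FreeGroup.norm_inv_eq

lemma wlen_letter {r : ℕ} (p : Fin r × Bool) : wlen (letter p) = 1 := by
  obtain ⟨i, b⟩ := p
  cases b
  · rw [letter_false, wlen_inv]; exact FreeGroup.norm_of i
  · rw [letter_true]; exact FreeGroup.norm_of i

lemma ballFin_mono {r : ℕ} : Monotone (ballFin r) := fun m n hmn g hg => by
  rw [mem_ballFin] at *
  omega

lemma smul_ballFin_subset {r : ℕ} (g : FG r) {m n : ℕ} (h : wlen g + m ≤ n) :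
    g • ballFin r m ⊆ ballFin r n := by
  intro x hx
  obtain ⟨y, hy, rfl⟩ := Finset.mem_smul_finset.1 hx
  rw [mem_ballFin] at *
  have := wlen_mul_le g y
  rw [smul_eq_mul]
  omega

lemma toWord_tail {r : ℕ} {g : FG r} {p : Fin r × Bool} {l : List (Fin r × Bool)}
    (hg : g.toWord = p :: l) : (FreeGroup.mk l).toWord = l := by
  have : FreeGroup.IsReduced (p :: l) := hg ▸ FreeGroup.isReduced_toWord
  rw [FreeGroup.toWord_mk]
  exact (this.infix (List.suffix_cons p l).isInfix).reduce_eq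

lemma eq_letter_mul {r : ℕ} {g : FG r} {p : Fin r × Bool} {l : List (Fin r × Bool)}
    (hg : g.toWord = p :: l) : g = letter p * FreeGroup.mk l := by
  rw [← mk_singleton_eq_letter, FreeGroup.mul_mk, ← FreeGroup.mk_toWord (x := g), hg]
  rfl

/-- The formal inverse of a letter. -/
def invLetter {r : ℕ} (p : Fin r × Bool) : Fin r × Bool := (p.1, !p.2)

lemma letter_invLetter {r : ℕ} (p : Fin r × Bool) : letter (invLetter p) = (letter p)⁻¹ := by
  obtain ⟨i, b⟩ := p
  cases b <;> simp [letter, invLetter]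

lemma ne_invLetter_of_toWord {r : ℕ} {g : FG r} {p p' : Fin r × Bool} {l : List (Fin r × Bool)}
    (hg : g.toWord = p :: p' :: l) : p' ≠ invLetter p := by
  have : FreeGroup.IsReduced (p :: p' :: l) := hg ▸ FreeGroup.isReduced_toWord
  have h2 := (List.isChain_cons_cons.1 this).1
  rintro rfl
  simp [invLetter] at h2

lemma exists_toWord_eq_cons_or_mem {r n : ℕ} (p : Fin r × Bool) {g : FG r}
    (hg : g ∈ letter p • ballFin r n) :
    (∃ l, g.toWord = p :: l) ∨ g ∈ ballFin r n := by
  obtain ⟨y, hy, rfl⟩ := Finset.mem_smul_finset.1 hg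
  rw [mem_ballFin] at hy
  rw [smul_eq_mul, mem_ballFin]
  have hword : (letter p * y).toWord = FreeGroup.reduce (p :: y.toWord) := by
    rw [← mk_singleton_eq_letter, FreeGroup.toWord_mul, FreeGroup.toWord_mk,
      FreeGroup.reduce_singleton]
    rfl
  rcases hyw : y.toWord with _ | ⟨p', l⟩
  · left
    rw [hword, hyw]
    exact ⟨[], FreeGroup.reduce_singleton p⟩
  · rw [wlen, hyw] at hy
    rw [wlen, hword, hyw, FreeGroup.reduce.cons]
    have hred : FreeGroup.reduce (p' :: l) = p' :: l := by
      rw [← hyw]; exact FreeGroup.reduce_toWord y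
    rw [hred]
    simp only
    split_ifs with hc
    · right
      simp at hy
      omega
    · exact Or.inl ⟨_, rfl⟩

/-- A nontrivial normal subgroup contains an element which moves every word starting with `s` to a
word that does not start with `s`. -/
lemma exists_mem_normal_head_ne {r : ℕ} (hr : 1 < r) {K : Subgroup (FG r)} (hK : K.Normal)
    (hK1 : K ≠ ⊥) (s : Fin r × Bool) :
    ∃ k ∈ K, ∀ (g : FG r) (l : List (Fin r × Bool)), g.toWord = s :: l →
      ∃ (p : Fin r × Bool) (l' : List (Fin r × Bool)), p ≠ s ∧ (k * g).toWord = p :: l' := by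
  obtain ⟨k₀, hk₀, hne⟩ := Subgroup.ne_bot_iff_exists_ne_one.1 hK1 |>.elim
    fun a ha => (⟨a.1, a.2, fun h => ha (Subtype.ext h)⟩ : ∃ k₀ : FG r, k₀ ∈ K ∧ k₀ ≠ 1)
  have hw : k₀.toWord ≠ [] := fun h => hne (FreeGroup.toWord_eq_nil_iff.1 h)
  obtain ⟨x, hx⟩ : ∃ x : Fin r × Bool,
      x ∉ ({invLetter (k₀.toWord.head hw), k₀.toWord.getLast hw, s} : Finset _) := by
    by_contra! hcon
    have h1 := Finset.card_le_card (fun x _ => hcon x :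
      (Finset.univ : Finset (Fin r × Bool)) ⊆ _)
    have h2 := Finset.card_le_three (a := invLetter (k₀.toWord.head hw))
      (b := k₀.toWord.getLast hw) (c := s)
    rw [Finset.card_univ, Fintype.card_prod, Fintype.card_fin, Fintype.card_bool] at h1
    omega
  simp only [Finset.mem_insert, Finset.mem_singleton, not_or] at hx
  obtain ⟨hx1, hx2, hx3⟩ := hx
  have hpair : ∀ {u v : Fin r × Bool}, u ≠ invLetter v → v.1 = u.1 → v.2 = u.2 := by
    rintro ⟨a, b⟩ ⟨c, d⟩ huv hac
    simp only at hac
    subst hac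
    simp only [invLetter, ne_eq, Prod.mk.injEq, true_and] at huv
    cases b <;> cases d <;> simp_all
  refine ⟨letter x * k₀ * (letter x)⁻¹, hK.conj_mem _ hk₀ _, fun g l hg => ?_⟩
  refine ⟨x, k₀.toWord ++ (invLetter x :: g.toWord), hx3, ?_⟩
  have hred : FreeGroup.IsReduced (x :: (k₀.toWord ++ (invLetter x :: g.toWord))) := by
    have hg' : FreeGroup.IsReduced (invLetter x :: g.toWord) := by
      have h0 : FreeGroup.IsReduced g.toWord := FreeGroup.isReduced_toWord
      rw [hg] at h0 ⊢
      refine List.isChain_cons_cons.2 ⟨?_, h0⟩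
      refine hpair ?_
      intro h
      apply hx3
      rw [h]
      simp [invLetter]
    have hk' : FreeGroup.IsReduced (k₀.toWord ++ (invLetter x :: g.toWord)) := by
      refine List.isChain_append.2 ⟨FreeGroup.isReduced_toWord, hg', ?_⟩
      intro a ha b hb
      rw [List.getLast?_eq_getLast_of_ne_nil hw, Option.mem_some_iff] at ha
      simp only [List.head?_cons, Option.mem_some_iff] at hb
      subst ha hb
      refine hpair ?_
      intro h
      apply hx2
      simpa [invLetter, Prod.ext_iff] using h
    rw [FreeGroup.IsReduced, List.isChain_cons]
    refine ⟨?_, hk'⟩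
    intro y hy
    rw [List.head?_append_of_ne_nil _ hw, List.head?_eq_some_head hw, Option.mem_some_iff] at hy
    subst hy
    refine hpair ?_
    intro h
    apply hx1
    rw [h]
    simp [invLetter]
  have heq : letter x * k₀ * (letter x)⁻¹ * g
      = FreeGroup.mk (x :: (k₀.toWord ++ (invLetter x :: g.toWord))) := by
    rw [← letter_invLetter, ← mk_singleton_eq_letter, ← mk_singleton_eq_letter]
    conv_lhs => rw [← FreeGroup.mk_toWord (x := k₀), ← FreeGroup.mk_toWord (x := g)]
    simp only [FreeGroup.mul_mk]
    simp
  rw [heq, FreeGroup.toWord_mk, hred.reduce_eq]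

/-! ### Lower bound for `F` on a factor -/

section Factor

variable {r : ℕ} {h : Finset (FG r) × Finset (FG r) → ℝ}

lemma latticeF_ballFin_succ_le (hh : IsInvSubmod (FG r) h) (m : ℕ) (Q : Finset (FG r)) :
    latticeF r h (ballFin r (m + 1), Q) ≤ latticeF r h (ballFin r m, Q) := by
  have key : ∀ S : Finset (Fin r × Bool),
      latticeF r h (ballFin r m ∪ S.biUnion (fun p => letter p • ballFin r m), Q)
        ≤ latticeF r h (ballFin r m, Q) := by
    intro S
    induction S using Finset.induction_on with
    | empty => simp
    | insert p S _ ih =>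
      refine le_trans (le_of_eq ?_) ((latticeF_splitting_le hh p
        (A := (ballFin r m, ∅))
        (W := (ballFin r m ∪ S.biUnion (fun p => letter p • ballFin r m), Q)) ?_).trans ih)
      · congr 1
        rw [Prod.smul_mk, Prod.mk_sup_mk, Finset.biUnion_insert, Finset.smul_finset_empty]
        simp only [Finset.sup_eq_union, Finset.union_empty]
        rw [Finset.union_assoc, Finset.union_comm (S.biUnion _)]
      · exact ⟨Finset.subset_union_left, Finset.empty_subset Q⟩
  refine le_trans (le_of_eq ?_) (key Finset.univ)
  congr 2
  ext g
  simp only [Finset.mem_union, Finset.mem_biUnion, Finset.mem_univ, true_and]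
  constructor
  · intro hg
    rcases hw : g.toWord with _ | ⟨p, l⟩
    · left
      rw [mem_ballFin, wlen, hw]
      simp
    · right
      refine ⟨p, Finset.mem_smul_finset.2 ⟨FreeGroup.mk l, ?_, (eq_letter_mul hw).symm⟩⟩
      rw [mem_ballFin, wlen] at *
      rw [toWord_tail hw]
      rw [hw, List.length_cons] at hg
      omega
  · rintro (hg | ⟨p, hg⟩)
    · exact ballFin_mono (Nat.le_succ m) hg
    · exact smul_ballFin_subset _ (by rw [wlen_letter]; omega) hg

lemma latticeF_ballFin_le_zero (hh : IsInvSubmod (FG r) h) (m : ℕ) (Q : Finset (FG r)) :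
    latticeF r h (ballFin r m, Q) ≤ latticeF r h (ballFin r 0, Q) := by
  induction m with
  | zero => exact le_rfl
  | succ m ih => exact (latticeF_ballFin_succ_le hh m Q).trans ih

lemma ballFin_zero : ballFin r 0 = {1} := by
  ext g
  rw [mem_ballFin, Finset.mem_singleton, Nat.le_zero]
  exact FreeGroup.norm_eq_zero

lemma ent_union_le_card_mul (hh : IsInvSubmod (FG r) h) {m q : ℕ} {ε : ℝ}
    (hε : h (ballFin r m, {1}) - h (ballFin r m, ∅) ≤ ε) (Q : Finset (FG r))
    (hQ : Q ⊆ ballFin r q) :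
    h (ballFin r (m + q), Q) ≤ h (ballFin r (m + q), ∅) + Q.card * ε := by
  induction Q using Finset.induction_on with
  | empty => simp
  | insert g Q hg ih =>
    have hgq : wlen g ≤ q := by simpa using hQ (Finset.mem_insert_self g Q)
    have ih' := ih ((Finset.subset_insert g Q).trans hQ)
    have hsub : g • ((ballFin r m, ∅) : Finset (FG r) × Finset (FG r))
        ≤ (ballFin r (m + q), Q) := by
      rw [Prod.smul_mk, Finset.smul_finset_empty]
      exact ⟨smul_ballFin_subset g (by omega), Finset.empty_subset Q⟩
    have hc := hh.cond_le hsub (g • ((∅, {1}) : Finset (FG r) × Finset (FG r)))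
    rw [hh.smul_sup_smul, hh.inv] at hc
    have e1 : ((ballFin r (m + q), Q) : Finset (FG r) × Finset (FG r)) ⊔ g • (∅, {1})
        = (ballFin r (m + q), insert g Q) := by
      rw [Prod.smul_mk, Finset.smul_finset_empty, Prod.mk_sup_mk, Finset.smul_finset_singleton]
      simp only [Finset.sup_eq_union, Finset.union_empty, smul_eq_mul, mul_one]
      rw [Finset.union_comm, Finset.insert_eq]
    have e2 : ((ballFin r m, ∅) : Finset (FG r) × Finset (FG r)) ⊔ (∅, {1})
        = (ballFin r m, {1}) := by
      simp
    rw [e1, e2] at hc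
    rw [Finset.card_insert_of_notMem hg]
    push_cast
    linarith

/-- If the second coordinate is asymptotically determined by the first one, then `F` of the
second coordinate is bounded below in terms of `F` of the first one. -/
lemma le_latticeF_snd (hr : 1 < r) (hh : IsInvSubmod (FG r) h) (h0 : h (∅, ∅) = 0)
    {f : ℝ} (hf : ∀ n, f ≤ latticeF r h (ballFin r n, ∅))
    (happ : ∀ ε > 0, ∃ m, h (ballFin r m, {1}) - h (ballFin r m, ∅) ≤ ε) (q : ℕ) :
    f - h ({1}, ∅) ≤ latticeF r h (∅, ballFin r q) := by
  have hr' : (1 : ℝ) < r := by exact_mod_cast hr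
  have hjoint : f ≤ latticeF r h (ballFin r 0, ballFin r q) := by
    refine le_of_forall_pos_le_add fun ε hε => ?_
    have hpos : 0 < (2 * (r : ℝ) - 1) * ((ballFin r q).card + 1) := by
      have : (0 : ℝ) ≤ (ballFin r q).card := Nat.cast_nonneg _
      apply mul_pos <;> linarith
    obtain ⟨m, hm⟩ := happ (ε / ((2 * (r : ℝ) - 1) * ((ballFin r q).card + 1))) (by positivity)
    have hu := ent_union_le_card_mul hh hm (ballFin r q) subset_rfl
    have hub : (2 * (r : ℝ) - 1) * ((ballFin r q).card *
        (ε / ((2 * (r : ℝ) - 1) * ((ballFin r q).card + 1)))) ≤ ε := by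
      have hcard : (0 : ℝ) < (ballFin r q).card + 1 := by positivity
      have h2r : (0 : ℝ) < 2 * (r : ℝ) - 1 := by linarith
      rw [show (2 * (r : ℝ) - 1) * ((ballFin r q).card *
        (ε / ((2 * (r : ℝ) - 1) * ((ballFin r q).card + 1))))
        = (ballFin r q).card * ε / ((ballFin r q).card + 1) by field_simp,
        div_le_iff₀ hcard]
      nlinarith
    have hmono : latticeF r h (ballFin r (m + q), ∅)
        ≤ latticeF r h (ballFin r (m + q), ballFin r q) + ε := by
      have hs : ∑ i : Fin r, h ((FreeGroup.of i : FG r) • (ballFin r (m + q), ∅)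
            ⊔ (ballFin r (m + q), ∅))
          ≤ ∑ i : Fin r, h ((FreeGroup.of i : FG r) • (ballFin r (m + q), ballFin r q)
            ⊔ (ballFin r (m + q), ballFin r q)) := by
        refine Finset.sum_le_sum fun i _ => hh.mono ?_
        have hle : ((ballFin r (m + q), ∅) : Finset (FG r) × Finset (FG r))
            ≤ (ballFin r (m + q), ballFin r q) := ⟨le_rfl, Finset.empty_subset _⟩
        exact sup_le_sup (hh.smul_le_smul _ hle) hle
      unfold latticeF
      have h2r : (0 : ℝ) < 2 * (r : ℝ) - 1 := by linarith
      have := mul_le_mul_of_nonneg_left hu h2r.le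
      linarith
    have := hf (m + q)
    have := latticeF_ballFin_le_zero hh (m + q) (ballFin r q)
    linarith
  set d : ℝ := h ({1}, ballFin r q) - h (∅, ballFin r q) with hd
  have hd1 : d ≤ h ({1}, ∅) := by
    have := hh.cond_le (U := (∅, ∅)) (W := (∅, ballFin r q))
      ⟨le_rfl, Finset.empty_subset _⟩ ({1}, ∅)
    simp only [Prod.mk_sup_mk, Finset.sup_eq_union, Finset.union_empty, Finset.empty_union,
      h0] at this
    linarith
  have hsum : ∀ i : Fin r, h ((FreeGroup.of i : FG r) • ({1}, ballFin r q)
      ⊔ ({1}, ballFin r q))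
      ≤ h ((FreeGroup.of i : FG r) • (∅, ballFin r q) ⊔ (∅, ballFin r q)) + 2 * d := by
    intro i
    set s : FG r := FreeGroup.of i
    set W : Finset (FG r) × Finset (FG r) := (∅, ballFin r q) with hW
    have hWd : h (W ⊔ ({1}, ∅)) - h W = d := by
      simp [hW, d]
    have e : ((({1}, ballFin r q)) : Finset (FG r) × Finset (FG r)) = W ⊔ ({1}, ∅) := by
      simp [hW]
    rw [e, hh.smul_sup, show s • W ⊔ s • ({1}, ∅) ⊔ (W ⊔ ({1}, ∅))
      = (s • W ⊔ W ⊔ ({1}, ∅)) ⊔ s • ({1}, ∅) by ac_rfl]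
    have h1 := hh.cond_le (U := W) (W := s • W ⊔ W) le_sup_right ({1}, ∅)
    have h2 := hh.cond_le (U := s • W) (W := s • W ⊔ W ⊔ ({1}, ∅))
      (le_sup_left.trans le_sup_left) (s • ({1}, ∅))
    rw [hh.smul_sup_smul, hh.inv] at h2
    linarith
  have hsum' := Finset.sum_le_sum fun i (_ : i ∈ Finset.univ) => hsum i
  rw [Finset.sum_add_distrib] at hsum'
  simp only [Finset.sum_const, Finset.card_univ, Fintype.card_fin, nsmul_eq_mul] at hsum'
  rw [ballFin_zero] at hjoint
  unfold latticeF at hjoint ⊢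
  have : h ({1}, ballFin r q) = h (∅, ballFin r q) + d := by rw [hd]; ring
  rw [this] at hjoint
  linarith

end Factor

/-! ### Bounded entropy for actions with a nontrivial normal subgroup acting trivially -/

section Collapse

variable {r : ℕ} {h : Finset (FG r) → ℝ}

/-- The conditional entropy of a neighbouring ball. -/
noncomputable def nbrEnt (h : Finset (FG r) → ℝ) (n : ℕ) (p : Fin r × Bool) : ℝ :=
  h (letter p • ballFin r n ∪ ballFin r n) - h (ballFin r n)

/-- The union of the balls of radius `n` centered at the reduced words of length between `1` and
`j` that start with the letter `p`. -/
noncomputable def branch (r n : ℕ) : ℕ → Fin r × Bool → Finset (FG r)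
  | 0, _ => ∅
  | j + 1, p => letter p • (ballFin r n ∪
      (Finset.univ.erase (invLetter p)).biUnion fun q => branch r n j q)

/-- An upper bound for the conditional entropy of `branch r n j p` given the ball of radius `n`. -/
noncomputable def branchEnt (h : Finset (FG r) → ℝ) (n : ℕ) : ℕ → Fin r × Bool → ℝ
  | 0, _ => 0
  | j + 1, p => nbrEnt h n p + ∑ p' ∈ Finset.univ.erase (invLetter p), branchEnt h n j p'

lemma ent_union_biUnion_le {B : Finset (FG r)} {ι : Type*} [DecidableEq ι]
    {V : ι → Finset (FG r)} {E : ι → ℝ}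
    (hV : ∀ p W, B ⊆ W → h (W ∪ V p) ≤ h W + E p) (S : Finset ι) {W : Finset (FG r)}
    (hW : B ⊆ W) : h (W ∪ S.biUnion V) ≤ h W + ∑ p ∈ S, E p := by
  induction S using Finset.induction_on with
  | empty => simp
  | insert p S hp ih =>
    rw [Finset.biUnion_insert, Finset.union_comm (V p), ← Finset.union_assoc,
      Finset.sum_insert hp]
    have := hV p (W ∪ S.biUnion V) (hW.trans Finset.subset_union_left)
    linarith

lemma ent_union_smul_le (hh : IsInvSubmod (FG r) h) {B V : Finset (FG r)} {E : ℝ}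
    (hV : ∀ W, B ⊆ W → h (W ∪ V) ≤ h W + E) (g : FG r) {W : Finset (FG r)} (hW : g • B ⊆ W) :
    h (W ∪ g • V) ≤ h W + E := by
  have h1 := hV (g⁻¹ • W) (by rwa [← Finset.smul_finset_subset_iff])
  rw [hh.inv] at h1
  rw [← hh.inv g⁻¹, Finset.smul_finset_union, inv_smul_smul]
  exact h1

lemma ent_union_smul_ballFin_le (hh : IsInvSubmod (FG r) h) (n : ℕ) (p : Fin r × Bool)
    {W : Finset (FG r)} (hW : ballFin r n ⊆ W) :
    h (W ∪ letter p • ballFin r n) ≤ h W + nbrEnt h n p := by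
  have := hh.cond_le (U := ballFin r n) (W := W) hW (letter p • ballFin r n)
  rw [Finset.sup_eq_union, Finset.sup_eq_union, Finset.union_comm (ballFin r n)] at this
  unfold nbrEnt
  linarith

lemma ent_union_branch_le (hh : IsInvSubmod (FG r) h) (n j : ℕ) (p : Fin r × Bool)
    (W : Finset (FG r)) (hW : ballFin r n ⊆ W) :
    h (W ∪ branch r n j p) ≤ h W + branchEnt h n j p := by
  induction j generalizing p W with
  | zero => simp [branch, branchEnt]
  | succ j ih =>
    rw [branch, branchEnt, Finset.smul_finset_union, ← Finset.union_assoc]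
    have h1 := ent_union_smul_ballFin_le hh n p hW
    have h2 := ent_union_smul_le hh (B := ballFin r n)
      (fun W hW => ent_union_biUnion_le ih (Finset.univ.erase (invLetter p)) hW)
      (letter p) (W := W ∪ letter p • ballFin r n) Finset.subset_union_right
    linarith

lemma mem_branch {n j : ℕ} {g : FG r} {p : Fin r × Bool} {l : List (Fin r × Bool)}
    (hg : g.toWord = p :: l) (hlen : wlen g ≤ n + j) : g ∈ ballFin r n ∪ branch r n j p := by
  induction j generalizing g p l with
  | zero => exact Finset.mem_union_left _ (by simpa using hlen)
  | succ j ih =>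
    refine Finset.mem_union_right _ ?_
    rw [branch]
    refine Finset.mem_smul_finset.2 ⟨FreeGroup.mk l, ?_, (eq_letter_mul hg).symm⟩
    have hl := toWord_tail hg
    have hlen' : wlen (FreeGroup.mk l) ≤ n + j := by
      rw [wlen, hg, List.length_cons] at hlen
      rw [wlen, hl]
      omega
    rcases l with _ | ⟨p', l⟩
    · exact Finset.mem_union_left _ (by rw [mem_ballFin, wlen, hl]; simp)
    · rcases Finset.mem_union.1 (ih hl hlen') with h1 | h1
      · exact Finset.mem_union_left _ h1
      · refine Finset.mem_union_right _ (Finset.mem_biUnion.2 ⟨p', ?_, h1⟩)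
        exact Finset.mem_erase.2 ⟨ne_invLetter_of_toWord hg, Finset.mem_univ _⟩

/-- The geometric sum `1 + (2r-1) + ⋯ + (2r-1)^(j-1)`. -/
noncomputable def branchCount (r : ℕ) : ℕ → ℝ
  | 0 => 0
  | j + 1 => 1 + (2 * (r : ℝ) - 1) * branchCount r j

lemma invLetter_invLetter (p : Fin r × Bool) : invLetter (invLetter p) = p := by
  simp [invLetter]

lemma sum_branchEnt (n j : ℕ) :
    ∑ p, branchEnt h n j p = branchCount r j * ∑ p, nbrEnt h n p := by
  induction j with
  | zero => simp [branchEnt, branchCount]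
  | succ j ih =>
    have hinv : ∑ p : Fin r × Bool, branchEnt h n j (invLetter p)
        = ∑ p, branchEnt h n j p :=
      (Function.Involutive.bijective invLetter_invLetter).sum_comp _
    have herase : ∀ p : Fin r × Bool,
        ∑ p' ∈ Finset.univ.erase (invLetter p), branchEnt h n j p'
          = ∑ p', branchEnt h n j p' - branchEnt h n j (invLetter p) := fun p => by
      rw [← Finset.add_sum_erase Finset.univ _ (Finset.mem_univ (invLetter p))]
      ring
    simp only [branchEnt, branchCount, herase, Finset.sum_add_distrib, Finset.sum_sub_distrib,
      hinv, Finset.sum_const, Finset.card_univ, Fintype.card_prod, Fintype.card_fin,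
      Fintype.card_bool, nsmul_eq_mul]
    rw [ih]
    push_cast
    ring

lemma sum_nbrEnt (hh : IsInvSubmod (FG r) h) (n : ℕ) :
    ∑ p, nbrEnt h n p
      = 2 * latticeF r h (ballFin r n) + (2 * (r : ℝ) - 2) * h (ballFin r n) := by
  have hfalse : ∀ i : Fin r, nbrEnt h n (i, false) = nbrEnt h n (i, true) := fun i => by
    unfold nbrEnt
    rw [letter_false, letter_true, ← hh.inv (FreeGroup.of i), Finset.smul_finset_union,
      smul_inv_smul, Finset.union_comm]
  rw [Fintype.sum_prod_type]
  simp only [Fintype.sum_bool, hfalse]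
  unfold nbrEnt latticeF
  simp only [letter_true, Finset.sum_add_distrib, Finset.sum_sub_distrib, Finset.sum_const,
    Finset.card_univ, Fintype.card_fin, nsmul_eq_mul, Finset.sup_eq_union]
  ring

lemma ent_ballFin_succ_ge (hh : IsInvSubmod (FG r) h) {f : ℝ}
    (hf : ∀ n, f ≤ latticeF r h (ballFin r n)) (n : ℕ) :
    (2 * (r : ℝ) - 1) * h (ballFin r n) + 2 * f ≤ h (ballFin r (n + 1)) := by
  have key : ∀ i : Fin r, h ((FreeGroup.of i : FG r) • ballFin r (n + 1) ⊔ ballFin r (n + 1))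
      ≤ 2 * h (ballFin r (n + 1)) - h ((FreeGroup.of i : FG r) • ballFin r n ⊔ ballFin r n) := by
    intro i
    have h1 := hh.submod ((FreeGroup.of i : FG r) • ballFin r (n + 1)) (ballFin r (n + 1))
    rw [hh.inv] at h1
    have h2 : h ((FreeGroup.of i : FG r) • ballFin r n ⊔ ballFin r n)
        ≤ h ((FreeGroup.of i : FG r) • ballFin r (n + 1) ⊓ ballFin r (n + 1)) := by
      have hl : wlen (FreeGroup.of i : FG r) = 1 := by rw [← letter_true, wlen_letter]
      refine hh.mono (sup_le (le_inf ?_ ?_) (le_inf ?_ ?_))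
      · exact hh.smul_le_smul _ (ballFin_mono (Nat.le_succ n))
      · exact smul_ballFin_subset _ (by omega)
      · have := smul_ballFin_subset (FreeGroup.of i : FG r)⁻¹ (m := n) (n := n + 1)
          (by rw [wlen_inv]; omega)
        have h3 := hh.smul_le_smul (FreeGroup.of i : FG r) this
        rwa [smul_inv_smul] at h3
      · exact ballFin_mono (Nat.le_succ n)
    linarith
  have hsum := Finset.sum_le_sum fun i (_ : i ∈ Finset.univ) => key i
  rw [Finset.sum_sub_distrib] at hsum
  simp only [Finset.sum_const, Finset.card_univ, Fintype.card_fin, nsmul_eq_mul] at hsum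
  have h1 := hf n
  have h2 := hf (n + 1)
  unfold latticeF at h1 h2
  linarith

lemma ent_ballFin_add_ge (hr : 1 < r) (hh : IsInvSubmod (FG r) h) {f : ℝ}
    (hf : ∀ n, f ≤ latticeF r h (ballFin r n)) (n j : ℕ) :
    (1 + (2 * (r : ℝ) - 2) * branchCount r j) * h (ballFin r n) + 2 * branchCount r j * f
      ≤ h (ballFin r (n + j)) := by
  have hr' : (1 : ℝ) < r := by exact_mod_cast hr
  induction j with
  | zero => simp [branchCount]
  | succ j ih =>
    have h1 := ent_ballFin_succ_ge hh hf (n + j)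
    have h2 := mul_le_mul_of_nonneg_left ih (by linarith : (0 : ℝ) ≤ 2 * (r : ℝ) - 1)
    rw [branchCount, ← add_assoc]
    linarith

/-- If a nontrivial normal subgroup acts trivially, the conditional entropy of neighbouring balls is
controlled by the decrease of `F`. -/
lemma exists_nbrEnt_le (hr : 1 < r) (hh : IsInvSubmod (FG r) h) {K : Subgroup (FG r)}
    (hK : K.Normal) (hK1 : K ≠ ⊥)
    (hcol : ∀ Q R : Finset (FG r), (∀ g ∈ R, ∃ k ∈ K, k * g ∈ Q) → h R ≤ h Q)
    {f : ℝ} (hf : ∀ n, f ≤ latticeF r h (ballFin r n)) (s : Fin r × Bool) :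
    ∃ D : ℝ, ∀ n, nbrEnt h n s ≤ D * (latticeF r h (ballFin r n) - f) := by
  obtain ⟨k, hk, hks⟩ := exists_mem_normal_head_ne hr hK hK1 s
  set L := wlen k with hL
  refine ⟨2 * branchCount r (L + 1), fun n => ?_⟩
  set A := ballFin r n ∪ (Finset.univ.erase s).biUnion (branch r n (L + 1)) with hA
  have hBA : ballFin r n ⊆ A := Finset.subset_union_left
  have hmemA : ∀ {g : FG r} {p : Fin r × Bool} {l : List (Fin r × Bool)}, g.toWord = p :: l →
      p ≠ s → wlen g ≤ n + (L + 1) → g ∈ A := by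
    intro g p l hg hps hlen
    rcases Finset.mem_union.1 (mem_branch hg hlen) with h1 | h1
    · exact Finset.mem_union_left _ h1
    · exact Finset.mem_union_right _ (Finset.mem_biUnion.2
        ⟨p, Finset.mem_erase.2 ⟨hps, Finset.mem_univ _⟩, h1⟩)
  have h1 : h A ≤ h (ballFin r n) + ∑ p ∈ Finset.univ.erase s, branchEnt h n (L + 1) p :=
    ent_union_biUnion_le (ent_union_branch_le hh n (L + 1)) _ subset_rfl
  have h2 : h (A ∪ letter s • ballFin r n) ≤ h A := by
    refine hcol _ _ fun g hg => ?_
    by_cases hgA : g ∈ A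
    · exact ⟨1, K.one_mem, by rwa [one_mul]⟩
    have hgs : g ∈ letter s • ballFin r n := (Finset.mem_union.1 hg).resolve_left hgA
    rcases exists_toWord_eq_cons_or_mem s hgs with ⟨l, hl⟩ | hgB
    · obtain ⟨p, l', hps, hw⟩ := hks g l hl
      refine ⟨k, hk, hmemA hw hps ?_⟩
      have h3 := smul_ballFin_subset (letter s) (m := n) (n := n + 1)
        (by rw [wlen_letter]; omega) hgs
      rw [mem_ballFin] at h3
      have := wlen_mul_le k g
      omega
    · exact absurd (hBA hgB) hgA
  have h3 := ent_union_smul_le hh (B := ballFin r n)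
    (fun W hW => ent_union_biUnion_le (ent_union_branch_le hh n L)
      (Finset.univ.erase (invLetter s)) hW)
    (letter s) (W := A ∪ letter s • ballFin r n) Finset.subset_union_right
  have h4 : h (ballFin r (n + (L + 1))) ≤ h (A ∪ letter s • ballFin r n ∪ letter s •
      (Finset.univ.erase (invLetter s)).biUnion (branch r n L)) := by
    refine hh.mono fun g hg => ?_
    rw [mem_ballFin] at hg
    rw [Finset.union_assoc, ← Finset.smul_finset_union]
    rcases hw : g.toWord with _ | ⟨p, l⟩
    · refine Finset.mem_union_left _ (hBA ?_)
      rw [mem_ballFin, wlen, hw]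
      simp
    · by_cases hps : p = s
      · subst hps
        rcases Finset.mem_union.1 (mem_branch hw hg) with h5 | h5
        · exact Finset.mem_union_left _ (hBA h5)
        · exact Finset.mem_union_right _ h5
      · exact Finset.mem_union_left _ (hmemA hw hps hg)
  have h5 := ent_ballFin_add_ge hr hh hf n (L + 1)
  have h6 : ∑ p, branchEnt h n (L + 1) p = branchEnt h n (L + 1) s
      + ∑ p ∈ Finset.univ.erase s, branchEnt h n (L + 1) p :=
    (Finset.add_sum_erase Finset.univ _ (Finset.mem_univ s)).symm
  rw [sum_branchEnt, sum_nbrEnt hh] at h6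
  have h7 : branchEnt h n (L + 1) s = nbrEnt h n s
      + ∑ p' ∈ Finset.univ.erase (invLetter s), branchEnt h n L p' := rfl
  linarith

lemma latticeF_ballFin_antitone (hh : IsInvSubmod (FG r) h) :
    Antitone fun n => latticeF r h (ballFin r n) := by
  have hh' : IsInvSubmod (FG r) fun A : Finset (FG r) × Finset (FG r) => h A.1 :=
    { mono := fun A B hAB => hh.mono hAB.1
      submod := fun A B => hh.submod A.1 B.1
      smul_sup := fun g A B => Prod.ext (hh.smul_sup g A.1 B.1) (Finset.smul_finset_union)
      inv := fun g A => hh.inv g A.1 }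
  exact antitone_nat_of_succ_le fun n => latticeF_ballFin_succ_le hh' n ∅

/-- If a nontrivial normal subgroup acts trivially and `F` is bounded below, then the entropy is
bounded. -/
lemma ent_ballFin_le (hr : 1 < r) (hh : IsInvSubmod (FG r) h) {K : Subgroup (FG r)}
    (hK : K.Normal) (hK1 : K ≠ ⊥)
    (hcol : ∀ Q R : Finset (FG r), (∀ g ∈ R, ∃ k ∈ K, k * g ∈ Q) → h R ≤ h Q)
    {f : ℝ} (hf : ∀ n, f ≤ latticeF r h (ballFin r n)) (n : ℕ) :
    h (ballFin r n) ≤ -f / ((r : ℝ) - 1) := by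
  have hr' : (1 : ℝ) < r := by exact_mod_cast hr
  set F : ℕ → ℝ := fun n => latticeF r h (ballFin r n) with hF
  have hbdd : BddBelow (Set.range F) := ⟨f, by rintro _ ⟨n, rfl⟩; exact hf n⟩
  set f' : ℝ := ⨅ n, F n with hf'
  have hf'le : ∀ n, f' ≤ F n := fun n => ciInf_le hbdd n
  have hff' : f ≤ f' := le_ciInf hf
  choose D hD using exists_nbrEnt_le hr hh hK hK1 hcol hf'le
  have hmono : Monotone fun n => h (ballFin r n) := fun m n hmn => hh.mono (ballFin_mono hmn)
  have hlim : Tendsto F atTop (nhds f') := tendsto_atTop_ciInf (latticeF_ballFin_antitone hh) hbdd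
  have hup : ∀ m, ((r : ℝ) - 1) * h (ballFin r m)
      ≤ (∑ p, D p) / 2 * (F m - f') - F m := by
    intro m
    have h1 := Finset.sum_le_sum fun p (_ : p ∈ Finset.univ) => hD p m
    rw [sum_nbrEnt hh, ← Finset.sum_mul] at h1
    change _ ≤ _ * (F m - f') at h1
    change 2 * F m + _ ≤ _ at h1
    linarith
  have hlim2 : Tendsto (fun m => (∑ p, D p) / 2 * (F m - f') - F m) atTop (nhds (-f')) := by
    have := ((hlim.sub_const f').const_mul ((∑ p, D p) / 2)).sub hlim
    simpa using this
  rw [le_div_iff₀ (by linarith)]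
  have h2 : ((r : ℝ) - 1) * h (ballFin r n) ≤ -f' := by
    refine ge_of_tendsto hlim2 ?_
    filter_upwards [eventually_ge_atTop n] with m hm
    exact le_trans (mul_le_mul_of_nonneg_left (hmono hm) (by linarith)) (hup m)
  linarith

end Collapse

/-! ### Shannon inequalities for countable partitions -/

/-- The information `-log p` of an event of probability `p`, equal to `∞` at `p = 0`. -/
noncomputable def info (p : ℝ≥0∞) : ℝ≥0∞ :=
  if p = 0 then ⊤ else ENNReal.ofReal (-Real.log p.toReal)

lemma info_le_info {p q : ℝ≥0∞} (hpq : p ≤ q) (hq : q ≠ ⊤) : info q ≤ info p := by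
  unfold info
  by_cases hp : p = 0
  · simp [hp]
  · have hq0 : q ≠ 0 := fun h => hp (le_zero_iff.1 (h ▸ hpq))
    rw [if_neg hp, if_neg hq0]
    refine ENNReal.ofReal_le_ofReal (neg_le_neg (Real.log_le_log ?_ ?_))
    · exact ENNReal.toReal_pos hp (ne_top_of_le_ne_top hq hpq)
    · exact ENNReal.toReal_mono hq hpq

lemma info_mul_self {p : ℝ≥0∞} (hp : p ≤ 1) :
    info p * p = ENNReal.ofReal (Real.negMulLog p.toReal) := by
  unfold info
  by_cases h0 : p = 0
  · simp [h0]
  · rw [if_neg h0]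
    have hpt : p ≠ ⊤ := ne_top_of_le_ne_top ENNReal.one_ne_top hp
    conv_lhs => rw [← ENNReal.ofReal_toReal hpt]
    rw [ENNReal.toReal_ofReal ENNReal.toReal_nonneg, ← ENNReal.ofReal_mul, Real.negMulLog]
    · congr 1; ring
    · rw [neg_nonneg]
      exact Real.log_nonpos ENNReal.toReal_nonneg (by
        simpa using ENNReal.toReal_mono ENNReal.one_ne_top hp)

section Shannon

set_option linter.unusedSectionVars false

variable {X : Type*} [MeasurableSpace X] {μ : Measure X} [IsProbabilityMeasure μ]
  {I J L : Type*} [Countable I] [MeasurableSpace I] [MeasurableSingletonClass I]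
  [Countable J] [MeasurableSpace J] [MeasurableSingletonClass J]
  [Countable L] [MeasurableSpace L] [MeasurableSingletonClass L]
  {a : X → I} {b : X → J} {c : X → L}

lemma lintegral_comp_eq_tsum (ha : Measurable a) (g : I → ℝ≥0∞) :
    ∫⁻ x, g (a x) ∂μ = ∑' i, g i * μ (a ⁻¹' {i}) := by
  rw [← lintegral_map (Measurable.of_discrete (f := g)) ha, lintegral_countable']
  refine tsum_congr fun i => ?_
  rw [Measure.map_apply ha (measurableSet_singleton i)]

lemma Hpart_eq_lintegral (ha : Measurable a) :
    Hpart μ a = ∫⁻ x, info (μ (a ⁻¹' {a x})) ∂μ := by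
  rw [lintegral_comp_eq_tsum ha (fun i => info (μ (a ⁻¹' {i})))]
  exact tsum_congr fun i => (info_mul_self prob_le_one).symm

lemma info_cell_le {x : X} (hab : ∀ y, a y = a x → b y = b x) :
    info (μ (b ⁻¹' {b x})) ≤ info (μ (a ⁻¹' {a x})) :=
  info_le_info (measure_mono fun y hy => hab y hy) (measure_ne_top _ _)

lemma Hpart_le_of_ker (ha : Measurable a) (hb : Measurable b)
    (hab : ∀ x y, a x = a y → b x = b y) : Hpart μ b ≤ Hpart μ a := by
  rw [Hpart_eq_lintegral ha, Hpart_eq_lintegral hb]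
  exact lintegral_mono fun x => info_cell_le fun y => hab y x

lemma Hpart_eq_of_ker (ha : Measurable a) (hb : Measurable b)
    (hab : ∀ x y, a x = a y ↔ b x = b y) : Hpart μ a = Hpart μ b :=
  le_antisymm (Hpart_le_of_ker hb ha fun x y => (hab x y).2)
    (Hpart_le_of_ker ha hb fun x y => (hab x y).1)

lemma Hpart_congr_ae {a' : X → I} (h : a =ᵐ[μ] a') : Hpart μ a = Hpart μ a' := by
  unfold Hpart
  refine tsum_congr fun i => ?_
  congr 3
  refine measure_congr ?_
  filter_upwards [h] with x hx
  exact propext (by change a x = i ↔ a' x = i; rw [hx])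

lemma Hpart_comp_measurePreserving {S : X → X} (hS : MeasurePreserving S μ μ)
    (ha : Measurable a) : Hpart μ (fun x => a (S x)) = Hpart μ a := by
  unfold Hpart
  refine tsum_congr fun i => ?_
  congr 3
  exact hS.measure_preimage (ha (measurableSet_singleton i)).nullMeasurableSet

lemma tsum_measure_preimage_inter_le (ha : Measurable a) {s : Set X} (hs : MeasurableSet s) :
    ∑' i, μ (a ⁻¹' {i} ∩ s) ≤ μ s := by
  refine (tsum_meas_le_meas_iUnion_of_disjoint μ
    (fun i => (ha (measurableSet_singleton i)).inter hs) ?_).trans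
    (measure_mono (iUnion_subset fun i => inter_subset_right))
  intro i j hij
  refine Set.disjoint_left.2 fun x hx hx' => hij ?_
  exact (hx.1 : a x = i).symm.trans hx'.1

lemma ae_measure_cell_ne_zero (a : X → I) : ∀ᵐ x ∂μ, μ (a ⁻¹' {a x}) ≠ 0 := by
  rw [ae_iff]
  have : {x | ¬ μ (a ⁻¹' {a x}) ≠ 0} ⊆ ⋃ i ∈ {i | μ (a ⁻¹' {i}) = 0}, a ⁻¹' {i} := by
    intro x hx
    simp only [ne_eq, not_not, mem_ofPred_eq] at hx
    simp only [mem_iUnion]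
    exact ⟨a x, hx, rfl⟩
  refine measure_mono_null this ?_
  rw [measure_biUnion_null_iff (Set.to_countable _)]
  exact fun i hi => hi

lemma info_add_info_add_one_le {p pc pac pbc : ℝ≥0∞} (hp : p ≠ 0) (h1 : p ≤ pac) (h2 : p ≤ pbc)
    (h3 : p ≤ pc) (hac : pac ≤ 1) (hbc : pbc ≤ 1) (hc : pc ≤ 1) :
    info p + info pc + 1 ≤ info pac + info pbc + pac * pbc / (pc * p) := by
  have hpos : ∀ {q : ℝ≥0∞}, p ≤ q → q ≤ 1 → ∃ t : ℝ, 0 < t ∧ t ≤ 1 ∧ q = ENNReal.ofReal t := by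
    intro q hpq hq1
    have hqt : q ≠ ⊤ := ne_top_of_le_ne_top ENNReal.one_ne_top hq1
    have hq0 : q ≠ 0 := fun h => hp (le_zero_iff.1 (h ▸ hpq))
    refine ⟨q.toReal, ENNReal.toReal_pos hq0 hqt, ?_, (ENNReal.ofReal_toReal hqt).symm⟩
    simpa using ENNReal.toReal_mono ENNReal.one_ne_top hq1
  have hinfo : ∀ {t : ℝ}, 0 < t → info (ENNReal.ofReal t) = ENNReal.ofReal (-Real.log t) := by
    intro t ht
    rw [info, if_neg (by simpa using ht), ENNReal.toReal_ofReal ht.le]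
  obtain ⟨t, ht0, ht1, rfl⟩ := hpos le_rfl (h3.trans hc)
  obtain ⟨u, hu0, hu1, rfl⟩ := hpos h1 hac
  obtain ⟨v, hv0, hv1, rfl⟩ := hpos h2 hbc
  obtain ⟨w, hw0, hw1, rfl⟩ := hpos h3 hc
  have nl : ∀ {t : ℝ}, 0 < t → t ≤ 1 → 0 ≤ -Real.log t := fun h h' =>
    neg_nonneg.2 (Real.log_nonpos h.le h')
  rw [hinfo ht0, hinfo hu0, hinfo hv0, hinfo hw0, ← ENNReal.ofReal_mul hu0.le,
    ← ENNReal.ofReal_mul hw0.le, ← ENNReal.ofReal_div_of_pos (by positivity),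
    ← ENNReal.ofReal_one, ← ENNReal.ofReal_add (nl ht0 ht1) (nl hw0 hw1),
    ← ENNReal.ofReal_add (by linarith [nl ht0 ht1, nl hw0 hw1]) zero_le_one,
    ← ENNReal.ofReal_add (nl hu0 hu1) (nl hv0 hv1),
    ← ENNReal.ofReal_add (by linarith [nl hu0 hu1, nl hv0 hv1]) (by positivity)]
  refine ENNReal.ofReal_le_ofReal ?_
  have hlog := Real.log_le_sub_one_of_pos (x := u * v / (w * t)) (by positivity)
  rw [Real.log_div (by positivity) (by positivity), Real.log_mul hu0.ne' hv0.ne',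
    Real.log_mul hw0.ne' ht0.ne'] at hlog
  linarith

lemma measurable_info_cell (ha : Measurable a) :
    Measurable fun x => info (μ (a ⁻¹' {a x})) :=
  (Measurable.of_discrete (f := fun i => info (μ (a ⁻¹' {i})))).comp ha

/-- Strong subadditivity of Shannon entropy. -/
lemma Hpart_submod (ha : Measurable a) (hb : Measurable b) (hc : Measurable c) :
    Hpart μ (fun x => (a x, b x, c x)) + Hpart μ c
      ≤ Hpart μ (fun x => (a x, c x)) + Hpart μ (fun x => (b x, c x)) := by
  have habc : Measurable fun x => (a x, b x, c x) := ha.prodMk (hb.prodMk hc)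
  have hac : Measurable fun x => (a x, c x) := ha.prodMk hc
  have hbc : Measurable fun x => (b x, c x) := hb.prodMk hc
  set P : I × J × L → ℝ≥0∞ := fun q => μ ((fun x => (a x, b x, c x)) ⁻¹' {q}) with hP
  set Pac : I × L → ℝ≥0∞ := fun q => μ ((fun x => (a x, c x)) ⁻¹' {q}) with hPac
  set Pbc : J × L → ℝ≥0∞ := fun q => μ ((fun x => (b x, c x)) ⁻¹' {q}) with hPbc
  set Pc : L → ℝ≥0∞ := fun q => μ (c ⁻¹' {q}) with hPc
  set Z : I × J × L → ℝ≥0∞ := fun q =>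
    Pac (q.1, q.2.2) * Pbc (q.2.1, q.2.2) / (Pc q.2.2 * P q) with hZ
  have hint : ∫⁻ x, Z (a x, b x, c x) ∂μ ≤ 1 := by
    rw [lintegral_comp_eq_tsum habc Z]
    have h1 : ∀ q : I × J × L, Z q * P q
        ≤ Pac (q.1, q.2.2) * (Pbc (q.2.1, q.2.2) * (Pc q.2.2)⁻¹) := by
      intro q
      have : Z q * P q = Pac (q.1, q.2.2) * (Pbc (q.2.1, q.2.2) * (Pc q.2.2)⁻¹)
          * ((P q)⁻¹ * P q) := by
        simp only [hZ]
        rw [div_eq_mul_inv, ENNReal.mul_inv (Or.inr (measure_ne_top _ _))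
          (Or.inl (measure_ne_top _ _))]
        ring
      rw [this]
      exact mul_le_of_le_one_right' (ENNReal.inv_mul_le_one _)
    refine (ENNReal.tsum_le_tsum h1).trans ?_
    rw [ENNReal.tsum_prod']
    have hsumI : ∀ l : L, ∑' i, Pac (i, l) ≤ Pc l := by
      intro l
      refine le_trans (le_of_eq (tsum_congr fun i => ?_)) (tsum_measure_preimage_inter_le ha
        (hc (measurableSet_singleton l)))
      simp only [hPac]
      congr 1
      ext x
      simp
    have hsumJ : ∀ l : L, ∑' j, Pbc (j, l) ≤ Pc l := by
      intro l
      refine le_trans (le_of_eq (tsum_congr fun i => ?_)) (tsum_measure_preimage_inter_le hb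
        (hc (measurableSet_singleton l)))
      simp only [hPbc]
      congr 1
      ext x
      simp
    have hsumL : ∑' l, Pc l ≤ 1 := by
      refine le_trans (le_of_eq (tsum_congr fun l => ?_)) ((tsum_measure_preimage_inter_le hc
        MeasurableSet.univ).trans_eq (measure_univ (μ := μ)))
      rw [inter_univ]
    calc ∑' i, ∑' q : J × L, Pac (i, q.2) * (Pbc (q.1, q.2) * (Pc q.2)⁻¹)
        = ∑' l, (∑' i, Pac (i, l)) * ((∑' j, Pbc (j, l)) * (Pc l)⁻¹) := by
          rw [ENNReal.tsum_comm, ENNReal.tsum_prod', ENNReal.tsum_comm]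
          refine tsum_congr fun l => ?_
          rw [← ENNReal.tsum_mul_right (a := (Pc l)⁻¹), ← ENNReal.tsum_mul_left]
          exact tsum_congr fun j => ENNReal.tsum_mul_right
      _ ≤ ∑' l, Pc l := by
          refine ENNReal.tsum_le_tsum fun l => ?_
          calc _ ≤ Pc l * (Pc l * (Pc l)⁻¹) := by
                gcongr
                · exact hsumI l
                · exact hsumJ l
            _ ≤ Pc l := mul_le_of_le_one_right' (ENNReal.mul_inv_le_one _)
      _ ≤ 1 := hsumL
  have hpt : ∀ᵐ x ∂μ, info (P (a x, b x, c x)) + info (Pc (c x)) + 1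
      ≤ info (Pac (a x, c x)) + info (Pbc (b x, c x)) + Z (a x, b x, c x) := by
    filter_upwards [ae_measure_cell_ne_zero (μ := μ) fun x => (a x, b x, c x)] with x hx
    refine info_add_info_add_one_le hx (measure_mono fun y hy => ?_)
      (measure_mono fun y hy => ?_) (measure_mono fun y hy => ?_) prob_le_one prob_le_one
      prob_le_one
    all_goals
      simp only [mem_preimage, mem_singleton_iff, Prod.mk.injEq] at hy ⊢
      simp [hy]
  have hle := lintegral_mono_ae hpt
  have hmac : Measurable fun x => info (Pac (a x, c x)) := measurable_info_cell hac
  have hmbc : Measurable fun x => info (Pbc (b x, c x)) := measurable_info_cell hbc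
  have hmabc : Measurable fun x => info (P (a x, b x, c x)) := measurable_info_cell habc
  have hmsum : Measurable fun x => info (Pac (a x, c x)) + info (Pbc (b x, c x)) :=
    hmac.add hmbc
  rw [lintegral_add_right _ measurable_const, lintegral_add_left hmabc,
    lintegral_add_left hmsum, lintegral_add_left hmac, lintegral_const, measure_univ,
    mul_one] at hle
  rw [Hpart_eq_lintegral habc, Hpart_eq_lintegral hc, Hpart_eq_lintegral hac,
    Hpart_eq_lintegral hbc]
  exact (ENNReal.add_le_add_iff_right ENNReal.one_ne_top).1
    (hle.trans (add_le_add le_rfl hint))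

/-- Subadditivity of Shannon entropy. -/
lemma Hpart_prod_le (ha : Measurable a) (hb : Measurable b) :
    Hpart μ (fun x => (a x, b x)) ≤ Hpart μ a + Hpart μ b := by
  have h := Hpart_submod (μ := μ) ha hb (measurable_const (a := ()))
  rw [Hpart_eq_of_ker (b := fun x => (a x, b x)) (by fun_prop) (by fun_prop) (by simp),
    Hpart_eq_of_ker (a := fun x => (a x, ())) (b := a) (by fun_prop) ha (by simp),
    Hpart_eq_of_ker (a := fun x => (b x, ())) (b := b) (by fun_prop) hb (by simp)] at h
  exact le_self_add.trans h

lemma Hpart_const (i : I) : Hpart μ (fun _ => i) = 0 := by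
  classical
  refine ENNReal.tsum_eq_zero.2 fun j => ?_
  by_cases hij : i = j <;> simp [hij]

lemma Hpart_lt_top_of_finite [Finite I] (a : X → I) : Hpart μ a < ⊤ := by
  have := Fintype.ofFinite I
  rw [Hpart, tsum_fintype]
  exact ENNReal.sum_lt_top.2 fun i _ => ENNReal.ofReal_lt_top

end Shannon

/-! ### Entropy of finite families of partitions -/

section Family

lemma fam_eq_iff {X κ : Type*} {Y : κ → X → ℕ} {P : Finset κ} {x y : X} :
    (fun p : P => Y p x) = (fun p : P => Y p y) ↔ ∀ p ∈ P, Y p x = Y p y := by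
  simp [funext_iff]

variable {X : Type*} [MeasurableSpace X] {κ : Type*}

/-- The Shannon entropy of the join of a finite subfamily of a family of partitions. -/
noncomputable def famEnt (μ : Measure X) (Y : κ → X → ℕ) (P : Finset κ) : ℝ≥0∞ :=
  Hpart μ (fun x (p : P) => Y p x)

lemma measurable_fam {Y : κ → X → ℕ} (hY : ∀ k, Measurable (Y k)) (P : Finset κ) :
    Measurable fun x (p : P) => Y p x :=
  measurable_pi_lambda _ fun p => hY p

variable {μ : Measure X} [IsProbabilityMeasure μ] {Y : κ → X → ℕ}

lemma famEnt_congr_ae {Y' : κ → X → ℕ} {P : Finset κ} (h : ∀ p ∈ P, Y p =ᵐ[μ] Y' p) :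
    famEnt μ Y P = famEnt μ Y' P := by
  refine Hpart_congr_ae ?_
  have : ∀ᵐ x ∂μ, ∀ p : P, Y p x = Y' p x := ae_all_iff.2 fun p => h p p.2
  filter_upwards [this] with x hx
  exact funext hx

lemma famEnt_le_of_ker {κ' : Type*} {Y' : κ' → X → ℕ} (hY : ∀ k, Measurable (Y k))
    (hY' : ∀ k, Measurable (Y' k)) {P : Finset κ} {Q : Finset κ'}
    (h : ∀ x y, (∀ p ∈ P, Y p x = Y p y) → ∀ q ∈ Q, Y' q x = Y' q y) :
    famEnt μ Y' Q ≤ famEnt μ Y P :=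
  Hpart_le_of_ker (measurable_fam hY P) (measurable_fam hY' Q) fun x y hxy =>
    fam_eq_iff.2 (h x y (fam_eq_iff.1 hxy))

lemma famEnt_mono (hY : ∀ k, Measurable (Y k)) {P Q : Finset κ} (hPQ : P ⊆ Q) :
    famEnt μ Y P ≤ famEnt μ Y Q :=
  famEnt_le_of_ker hY hY fun _ _ h p hp => h p (hPQ hp)

lemma famEnt_union_add_inter_le [DecidableEq κ] (hY : ∀ k, Measurable (Y k)) (P Q : Finset κ) :
    famEnt μ Y (P ∪ Q) + famEnt μ Y (P ∩ Q) ≤ famEnt μ Y P + famEnt μ Y Q := by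
  have hm := measurable_fam hY
  have key := Hpart_submod (μ := μ) (hm P) (hm Q) (hm (P ∩ Q))
  rw [Hpart_eq_of_ker (b := fun x (p : ↥(P ∪ Q)) => Y p x)
      ((hm P).prodMk ((hm Q).prodMk (hm (P ∩ Q)))) (hm _) fun x y => ?_,
    Hpart_eq_of_ker (a := fun x => ((fun p : P => Y p x), fun p : ↥(P ∩ Q) => Y p x))
      (b := fun x (p : P) => Y p x) ((hm P).prodMk (hm (P ∩ Q))) (hm _) fun x y => ?_,
    Hpart_eq_of_ker (a := fun x => ((fun p : Q => Y p x), fun p : ↥(P ∩ Q) => Y p x))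
      (b := fun x (p : Q) => Y p x) ((hm Q).prodMk (hm (P ∩ Q))) (hm _) fun x y => ?_] at key
  · exact key
  all_goals
    simp only [Prod.mk.injEq, fam_eq_iff, Finset.mem_union, Finset.mem_inter]
    grind

lemma famEnt_empty (hY : ∀ k, Measurable (Y k)) : famEnt μ Y ∅ = 0 := by
  refine le_antisymm ?_ bot_le
  refine (Hpart_le_of_ker (a := fun _ : X => ()) measurable_const (measurable_fam hY _) ?_).trans
    (Hpart_const ()).le
  exact fun x y _ => fam_eq_iff.2 (by simp)

lemma famEnt_le_sum (hY : ∀ k, Measurable (Y k)) (P : Finset κ) :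
    famEnt μ Y P ≤ ∑ p ∈ P, Hpart μ (Y p) := by
  classical
  have hm := measurable_fam hY
  induction P using Finset.induction_on with
  | empty => simp [famEnt_empty hY]
  | insert k P hk ih =>
    rw [Finset.sum_insert hk]
    refine (Hpart_le_of_ker ((hY k).prodMk (hm P)) (hm _) ?_).trans
      ((Hpart_prod_le (hY k) (hm P)).trans (add_le_add le_rfl ih))
    intro x y hxy
    rw [Prod.mk.injEq, fam_eq_iff] at hxy
    exact fam_eq_iff.2 (by simpa using hxy)

lemma famEnt_lt_top (hY : ∀ k, Measurable (Y k)) (hfin : ∀ k, Hpart μ (Y k) < ⊤)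
    (P : Finset κ) : famEnt μ Y P < ⊤ :=
  (famEnt_le_sum hY P).trans_lt (ENNReal.sum_lt_top.2 fun p _ => hfin p)

end Family

/-! ### Joint entropy of translates of two partitions -/

lemma BorelAction.tr_act_inv {G X I : Type*} [Group G] [MeasurableSpace X]
    (T : BorelAction G X) (a : X → I) (g s : G) (x : X) :
    T.tr g a (T.act s⁻¹ x) = T.tr (s * g) a x := by
  simp only [BorelAction.tr, mul_inv_rev, T.act_mul]

section Joint

variable {r : ℕ} {X : Type*} [MeasurableSpace X]

/-- The family of all translates of the two partitions `a` and `b`. -/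
def pairFam (T : BorelAction (FG r) X) (a b : X → ℕ) : FG r ⊕ FG r → X → ℕ :=
  Sum.elim (fun g => T.tr g a) (fun g => T.tr g b)

/-- The entropy `H(P·a ∨ Q·b)` as a function of the pair `(P, Q)`. -/
noncomputable def pairEnt (μ : Measure X) (T : BorelAction (FG r) X) (a b : X → ℕ)
    (A : Finset (FG r) × Finset (FG r)) : ℝ :=
  (famEnt μ (pairFam T a b) (A.1.disjSum A.2)).toReal

lemma pairFam_ker_iff {T : BorelAction (FG r) X} {a b : X → ℕ} {P Q : Finset (FG r)} {x y : X} :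
    (∀ k ∈ P.disjSum Q, pairFam T a b k x = pairFam T a b k y) ↔
      (∀ p ∈ P, T.tr p a x = T.tr p a y) ∧ ∀ q ∈ Q, T.tr q b x = T.tr q b y := by
  simp [pairFam, Finset.mem_disjSum]

variable {μ : Measure X} [IsProbabilityMeasure μ] {T : BorelAction (FG r) X} {a b : X → ℕ}

lemma measurable_pairFam (ha : Measurable a) (hb : Measurable b) (k : FG r ⊕ FG r) :
    Measurable (pairFam T a b k) := by
  rcases k with g | g
  · exact ha.comp (T.measurable_act _)
  · exact hb.comp (T.measurable_act _)

lemma Hpart_pairFam_lt_top (hT : T.Preserves μ) (ha : Measurable a) (hb : Measurable b)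
    (hfa : Hpart μ a < ⊤) (hfb : Hpart μ b < ⊤) (k : FG r ⊕ FG r) :
    Hpart μ (pairFam T a b k) < ⊤ := by
  rcases k with g | g
  · exact (Hpart_comp_measurePreserving (hT g⁻¹) ha).trans_lt hfa
  · exact (Hpart_comp_measurePreserving (hT g⁻¹) hb).trans_lt hfb

lemma pairEnt_inv (hT : T.Preserves μ) (ha : Measurable a) (hb : Measurable b) (g : FG r)
    (A : Finset (FG r) × Finset (FG r)) : pairEnt μ T a b (g • A) = pairEnt μ T a b A := by
  have hm := measurable_pairFam (T := T) ha hb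
  unfold pairEnt
  congr 1
  rw [famEnt, famEnt, ← Hpart_comp_measurePreserving (hT g⁻¹) (measurable_fam hm (A.1.disjSum A.2))]
  refine Hpart_eq_of_ker (measurable_fam hm _)
    ((measurable_fam hm _).comp (T.measurable_act g⁻¹)) fun x y => ?_
  rw [fam_eq_iff, fam_eq_iff, pairFam_ker_iff, pairFam_ker_iff]
  simp only [T.tr_act_inv, Prod.smul_fst, Prod.smul_snd, Finset.mem_smul_finset, smul_eq_mul,
    forall_exists_index, and_imp, forall_apply_eq_imp_iff₂]

lemma isInvSubmod_pairEnt (hT : T.Preserves μ) (ha : Measurable a) (hb : Measurable b)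
    (hfa : Hpart μ a < ⊤) (hfb : Hpart μ b < ⊤) : IsInvSubmod (FG r) (pairEnt μ T a b) where
  mono A B hAB := by
    refine ENNReal.toReal_mono (famEnt_lt_top (measurable_pairFam ha hb)
      (Hpart_pairFam_lt_top hT ha hb hfa hfb) _).ne (famEnt_mono (measurable_pairFam ha hb) ?_)
    exact Finset.disjSum_mono hAB.1 hAB.2
  submod A B := by
    have hm := measurable_pairFam (T := T) ha hb
    have hfin := fun P => (famEnt_lt_top (μ := μ) hm (Hpart_pairFam_lt_top hT ha hb hfa hfb) P).ne
    unfold pairEnt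
    rw [← ENNReal.toReal_add (hfin _) (hfin _), ← ENNReal.toReal_add (hfin _) (hfin _)]
    refine ENNReal.toReal_mono (ENNReal.add_ne_top.2 ⟨hfin _, hfin _⟩) ?_
    have key := famEnt_union_add_inter_le (μ := μ) hm (A.1.disjSum A.2) (B.1.disjSum B.2)
    convert key using 3
    · ext (g | g) <;> simp
    · ext (g | g) <;> simp
  smul_sup g A B := Prod.ext (Finset.smul_finset_union) (Finset.smul_finset_union)
  inv := pairEnt_inv hT ha hb

lemma IsInvSubmod.snd {h : Finset (FG r) × Finset (FG r) → ℝ} (hh : IsInvSubmod (FG r) h) :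
    IsInvSubmod (FG r) fun Q => h (∅, Q) where
  mono _ _ hAB := hh.mono ⟨le_rfl, hAB⟩
  submod A B := by simpa using hh.submod (∅, A) (∅, B)
  smul_sup g A B := Finset.smul_finset_union
  inv g A := by simpa using hh.inv g (∅, A)

lemma latticeF_snd (h : Finset (FG r) × Finset (FG r) → ℝ) (Q : Finset (FG r)) :
    latticeF r (fun Q => h (∅, Q)) Q = latticeF r h (∅, Q) := by
  simp [latticeF]

lemma pairEnt_empty (ha : Measurable a) (hb : Measurable b) :
    pairEnt μ T a b (∅, ∅) = 0 := by
  simp [pairEnt, famEnt_empty (measurable_pairFam (T := T) ha hb)]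

lemma latticeF_pairEnt_ballFin (ha : Measurable a) (hb : Measurable b) (n : ℕ) :
    latticeF r (pairEnt μ T a b) (ballFin r n, ∅) = fSeq μ T a n := by
  have hm := measurable_pairFam (T := T) ha hb
  have hj : Measurable (T.joinF (ball r n) a) :=
    measurable_pi_lambda _ fun f => ha.comp (T.measurable_act _)
  have hker : ∀ x y, T.joinF (ball r n) a x = T.joinF (ball r n) a y ↔
      ∀ p ∈ ballFin r n, T.tr p a x = T.tr p a y := by
    intro x y
    simp only [funext_iff, Subtype.forall, mem_ballFin]
    rfl
  unfold latticeF fSeq FF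
  refine congrArg₂ (· + ·) (congrArg _ ?_) (Finset.sum_congr rfl fun i _ => ?_)
  · unfold pairEnt famEnt
    congr 1
    refine Hpart_eq_of_ker (measurable_fam hm _) hj fun x y => ?_
    rw [fam_eq_iff, pairFam_ker_iff, hker]
    simp
  · unfold pairEnt famEnt
    congr 1
    refine Hpart_eq_of_ker (measurable_fam hm _) ((hj.comp (T.measurable_act _)).prodMk hj)
      fun x y => ?_
    rw [fam_eq_iff, pairFam_ker_iff, Prod.mk.injEq]
    have h1 : T.tr (FreeGroup.of i) (T.joinF (ball r n) a) x
        = T.joinF (ball r n) a (T.act (FreeGroup.of i)⁻¹ x) := rfl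
    have h2 : T.tr (FreeGroup.of i) (T.joinF (ball r n) a) y
        = T.joinF (ball r n) a (T.act (FreeGroup.of i)⁻¹ y) := rfl
    rw [h1, h2, hker, hker]
    simp only [T.tr_act_inv, Prod.fst_sup, Prod.snd_sup, Prod.smul_fst, Prod.smul_snd,
      Finset.sup_eq_union, Finset.mem_union, or_imp, forall_and, Finset.mem_smul_finset,
      smul_eq_mul, forall_exists_index, and_imp, forall_apply_eq_imp_iff₂]
    simp

end Joint

/-! ### The partition generated by finitely many sets -/

section SetPart

variable {X : Type*} {k : ℕ}

open Classical in
/-- The partition generated by finitely many sets. -/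
noncomputable def setPart (B : Fin k → Set X) (x : X) : ℕ :=
  Encodable.encode fun i => decide (x ∈ B i)

lemma setPart_eq_iff {B : Fin k → Set X} {x y : X} :
    setPart B x = setPart B y ↔ ∀ i, x ∈ B i ↔ y ∈ B i := by
  simp [setPart, Encodable.encode_inj, funext_iff]

variable [MeasurableSpace X] {B : Fin k → Set X}

open Classical in
lemma measurable_decide_mem (hB : ∀ i, MeasurableSet (B i)) :
    Measurable fun x i => decide (x ∈ B i) := by
  refine measurable_pi_lambda _ fun i => measurable_to_bool ?_
  convert hB i using 1
  ext x
  simp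

lemma measurable_setPart (hB : ∀ i, MeasurableSet (B i)) : Measurable (setPart B) :=
  (Measurable.of_discrete (f := (Encodable.encode : (Fin k → Bool) → ℕ))).comp
    (measurable_decide_mem hB)

lemma Hpart_setPart_lt_top {μ : Measure X} [IsProbabilityMeasure μ]
    (hB : ∀ i, MeasurableSet (B i)) : Hpart μ (setPart B) < ⊤ := by
  classical
  refine (Hpart_le_of_ker (measurable_decide_mem hB) (measurable_setPart hB) fun x y hxy => ?_).trans_lt
    (Hpart_lt_top_of_finite _)
  rw [setPart_eq_iff]
  simpa [funext_iff] using hxy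

end SetPart

/-! ### Approximation along a generating partition -/

lemma exists_Hpart_indicator_le {X : Type*} [MeasurableSpace X] (μ : Measure X)
    [IsProbabilityMeasure μ] {ε : ℝ} (hε : 0 < ε) :
    ∃ δ : ℝ≥0∞, 0 < δ ∧ ∀ E : Set X, MeasurableSet E → μ E < δ →
      Hpart μ (E.indicator (1 : X → ℕ)) ≤ ENNReal.ofReal ε := by
  have hcont : Continuous fun t : ℝ => Real.negMulLog t + Real.negMulLog (1 - t) := by
    fun_prop
  have hev := hcont.continuousAt.eventually_lt (x₀ := (0 : ℝ))
    (continuousAt_const (y := ε)) (by simpa using hε)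
  obtain ⟨δ, hδ, hball⟩ := Metric.eventually_nhds_iff.1 hev
  refine ⟨ENNReal.ofReal δ, by simpa using hδ, fun E hE hlt => ?_⟩
  have hlt' : (μ E).toReal < δ := ENNReal.toReal_lt_of_lt_ofReal hlt
  have h1 : E.indicator (1 : X → ℕ) ⁻¹' {1} = E := by
    ext x
    by_cases hx : x ∈ E <;> simp [hx]
  have h0 : E.indicator (1 : X → ℕ) ⁻¹' {0} = Eᶜ := by
    ext x
    by_cases hx : x ∈ E <;> simp [hx]
  have hcompl : (μ Eᶜ).toReal = 1 - (μ E).toReal := by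
    rw [prob_compl_eq_one_sub hE, ENNReal.toReal_sub_of_le prob_le_one ENNReal.one_ne_top,
      ENNReal.toReal_one]
  have hle1 : (μ E).toReal ≤ 1 := by
    simpa using ENNReal.toReal_mono ENNReal.one_ne_top (prob_le_one (μ := μ) (s := E))
  rw [Hpart, tsum_eq_sum (s := {0, 1}), Finset.sum_pair zero_ne_one, h0, h1, hcompl,
    ← ENNReal.ofReal_add, add_comm]
  · refine ENNReal.ofReal_le_ofReal (hball ?_).le
    simpa [abs_of_nonneg ENNReal.toReal_nonneg] using hlt'
  · exact Real.negMulLog_nonneg (by linarith) (by linarith [ENNReal.toReal_nonneg (a := μ E)])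
  · exact Real.negMulLog_nonneg ENNReal.toReal_nonneg hle1
  · intro i hi
    have : E.indicator (1 : X → ℕ) ⁻¹' {i} = ∅ := by
      ext x
      by_cases hx : x ∈ E <;> simp [hx] <;> grind
    simp [this]

section Approx

variable {r : ℕ} {X : Type*} [mX : MeasurableSpace X] {μ : Measure X} [IsProbabilityMeasure μ]
  {T : BorelAction (FG r) X} {a : X → ℕ}

/-- Up to small measure, every measurable set is a union of cells of some `B_m · α`. -/
lemma exists_measure_symmDiff_lt_of_generating (ha : Measurable a) (hgen : T.Generating a μ)
    {B : Set X} (hB : MeasurableSet B) {ε : ℝ≥0∞} (hε : 0 < ε) :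
    ∃ (m : ℕ) (A : Set X), MeasurableSet A ∧ μ (A ∆ B) < ε ∧
      ∀ x y, (∀ p ∈ ballFin r m, T.tr p a x = T.tr p a y) → (x ∈ A ↔ y ∈ A) := by
  set C : Set (Set X) := {s | MeasurableSet s ∧ ∃ m, ∀ x y,
    (∀ p ∈ ballFin r m, T.tr p a x = T.tr p a y) → (x ∈ s ↔ y ∈ s)} with hC
  have hle : MeasurableSpace.generateFrom C ≤ mX :=
    MeasurableSpace.generateFrom_le fun s hs => hs.1
  have hring : IsSetRing C := by
    refine ⟨⟨MeasurableSet.empty, 0, by simp⟩, ?_, ?_⟩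
    · rintro s t ⟨hs, m, hm⟩ ⟨ht, n, hn⟩
      refine ⟨hs.union ht, max m n, fun x y h => ?_⟩
      rw [mem_union, mem_union, hm x y fun p hp => h p (ballFin_mono (le_max_left _ _) hp),
        hn x y fun p hp => h p (ballFin_mono (le_max_right _ _) hp)]
    · rintro s t ⟨hs, m, hm⟩ ⟨ht, n, hn⟩
      refine ⟨hs.diff ht, max m n, fun x y h => ?_⟩
      rw [Set.mem_sdiff, Set.mem_sdiff, hm x y fun p hp => h p (ballFin_mono (le_max_left _ _) hp),
        hn x y fun p hp => h p (ballFin_mono (le_max_right _ _) hp)]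
  have hpart : T.partSA Set.univ a ≤ MeasurableSpace.generateFrom C := by
    refine iSup₂_le fun f _ => ?_
    rintro _ ⟨t, -, rfl⟩
    refine MeasurableSpace.measurableSet_generateFrom
      ⟨(ha.comp (T.measurable_act _)) (MeasurableSet.of_discrete (s := t)), wlen f,
        fun x y h => ?_⟩
    rw [mem_preimage, mem_preimage, h f (by simp)]
  obtain ⟨B', hB', hBB'⟩ := hgen B hB
  have hB'C := hpart _ hB'
  have huniv : (Set.univ : Set X) ∈ C := ⟨MeasurableSet.univ, 0, by simp⟩
  obtain ⟨A, hA, hlt⟩ := @exists_measure_symmDiff_lt_of_generateFrom_isSetRing X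
    (MeasurableSpace.generateFrom C) (μ.trim hle) _ C hring
    ⟨{Set.univ}, by simp, by simpa using huniv, by simp⟩ rfl B' hB'C ε hε
  rw [trim_measurableSet_eq hle (MeasurableSet.symmDiff
    (MeasurableSpace.measurableSet_generateFrom hA) hB'C)] at hlt
  obtain ⟨hAm, m, hm⟩ := hA
  refine ⟨m, A, hAm, ?_, hm⟩
  refine (measure_symmDiff_le A B' B).trans_lt ?_
  rwa [symmDiff_comm B' B, hBB', add_zero]

lemma exists_pairEnt_sub_le (hT : T.Preserves μ) (ha : Measurable a) (hgen : T.Generating a μ)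
    (hfa : Hpart μ a < ⊤) {k : ℕ} {B : Fin k → Set X} (hB : ∀ i, MeasurableSet (B i))
    {ε : ℝ} (hε : 0 < ε) :
    ∃ m, pairEnt μ T a (setPart B) (ballFin r m, {1})
      - pairEnt μ T a (setPart B) (ballFin r m, ∅) ≤ ε := by
  have hb := measurable_setPart hB
  have hpm := measurable_pairFam (T := T) ha hb
  obtain ⟨δ, hδ, hsmall⟩ := exists_Hpart_indicator_le μ (ε := ε / (k + 1)) (by positivity)
  choose m A hA hAB hdet using fun i =>
    exists_measure_symmDiff_lt_of_generating ha hgen (hB i) hδ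
  set N := Finset.univ.sup m
  set D : Fin k → X → ℕ := fun i => (A i ∆ B i).indicator 1 with hD
  have hDm : ∀ i, Measurable (D i) := fun i =>
    measurable_one.indicator ((hA i).symmDiff (hB i))
  have hDent : famEnt μ D Finset.univ ≤ ENNReal.ofReal ε := by
    refine (famEnt_le_sum hDm _).trans ((Finset.sum_le_card_nsmul _ _ _ fun i _ =>
      hsmall _ ((hA i).symmDiff (hB i)) (hAB i)).trans ?_)
    rw [Finset.card_univ, Fintype.card_fin, nsmul_eq_mul, ← ENNReal.ofReal_natCast,
      ← ENNReal.ofReal_mul (Nat.cast_nonneg k)]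
    refine ENNReal.ofReal_le_ofReal ?_
    rw [mul_div_assoc', div_le_iff₀ (by positivity)]
    nlinarith
  have hle : famEnt μ (pairFam T a (setPart B)) ((ballFin r N).disjSum {1})
      ≤ famEnt μ (pairFam T a (setPart B)) ((ballFin r N).disjSum ∅)
        + famEnt μ D Finset.univ := by
    refine le_trans (Hpart_le_of_ker ((measurable_fam hpm _).prodMk (measurable_fam hDm _))
      (measurable_fam hpm _) fun x y hxy => ?_)
      (Hpart_prod_le (measurable_fam hpm _) (measurable_fam hDm _))
    rw [Prod.mk.injEq, fam_eq_iff, fam_eq_iff, pairFam_ker_iff] at hxy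
    obtain ⟨⟨hx1, -⟩, hx2⟩ := hxy
    rw [fam_eq_iff, pairFam_ker_iff]
    refine ⟨hx1, ?_⟩
    simp only [Finset.mem_singleton, forall_eq, BorelAction.tr, inv_one, T.act_one]
    rw [setPart_eq_iff]
    intro i
    have hAi := hdet i x y fun p hp =>
      hx1 p (ballFin_mono (Finset.le_sup (f := m) (Finset.mem_univ i)) hp)
    have hDi := hx2 i (Finset.mem_univ i)
    classical
    simp only [hD, indicator_apply, mem_symmDiff, Pi.one_apply] at hDi
    clear hx1 hx2 hdet hsmall
    grind
  have hfin := fun P => (famEnt_lt_top (μ := μ) hpm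
    (Hpart_pairFam_lt_top hT ha hb hfa (Hpart_setPart_lt_top hB)) P).ne
  refine ⟨N, ?_⟩
  rw [sub_le_iff_le_add']
  have := ENNReal.toReal_mono (ENNReal.add_ne_top.2 ⟨hfin _, ENNReal.ofReal_ne_top⟩)
    (hle.trans (add_le_add le_rfl hDent))
  rwa [ENNReal.toReal_add (hfin _) ENNReal.ofReal_ne_top, ENNReal.toReal_ofReal hε.le] at this

/-- Enlarging a finite set modulo a normal subgroup fixing `b` does not increase entropy. -/
lemma pairEnt_le_of_normal (hT : T.Preserves μ) (ha : Measurable a) (hfa : Hpart μ a < ⊤)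
    {b : X → ℕ} (hb : Measurable b) (hfb : Hpart μ b < ⊤) {K : Subgroup (FG r)}
    (hK : K.Normal) (hinv : ∀ g ∈ K, T.tr g b =ᵐ[μ] b) {Q R : Finset (FG r)}
    (hQR : ∀ g ∈ R, ∃ κ ∈ K, κ * g ∈ Q) :
    pairEnt μ T a b (∅, R) ≤ pairEnt μ T a b (∅, Q) := by
  have hm := measurable_pairFam (T := T) ha hb
  choose! κ hκ hκQ using hQR
  refine ENNReal.toReal_mono (famEnt_lt_top hm (Hpart_pairFam_lt_top hT ha hb hfa hfb) _).ne ?_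
  set Y : FG r ⊕ FG r → X → ℕ :=
    Sum.elim (fun g => T.tr g a) (fun g => T.tr (κ g * g) b) with hY
  have hYm : ∀ q, Measurable (Y q) := by
    rintro (g | g)
    · exact ha.comp (T.measurable_act _)
    · exact hb.comp (T.measurable_act _)
  have hae : famEnt μ (pairFam T a b) (Finset.disjSum ∅ R) = famEnt μ Y (Finset.disjSum ∅ R) := by
    refine famEnt_congr_ae fun q hq => ?_
    obtain ⟨g, hg, rfl⟩ : ∃ g ∈ R, Sum.inr g = q := by simpa using hq
    have hmem : g⁻¹ * κ g * g ∈ K := by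
      simpa using hK.conj_mem (κ g) (hκ g hg) g⁻¹
    have h1 := (hT g⁻¹).quasiMeasurePreserving.ae_eq_comp (hinv _ hmem)
    filter_upwards [h1] with x hx
    change T.tr g b x = T.tr (κ g * g) b x
    have h2 : T.tr (g⁻¹ * κ g * g) b (T.act g⁻¹ x) = b (T.act g⁻¹ x) := hx
    rw [T.tr_act_inv] at h2
    rw [show κ g * g = g * (g⁻¹ * κ g * g) by group, h2]
    rfl
  rw [hae]
  refine famEnt_le_of_ker hm hYm fun x y hxy q hq => ?_
  obtain ⟨g, hg, rfl⟩ : ∃ g ∈ R, Sum.inr g = q := by simpa using hq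
  exact (pairFam_ker_iff.1 hxy).2 _ (hκQ g hg)

end Approx

/-! ### Bounded entropy of ball joins and ergodicity -/

section Ergodic

variable {r : ℕ} {X : Type*} [MeasurableSpace X] {μ : Measure X} [IsProbabilityMeasure μ]
  {T : BorelAction (FG r) X} {b : X → ℕ}

/-- The information function of the partition `B_n · b`. -/
noncomputable def ballInfo (μ : Measure X) (T : BorelAction (FG r) X) (b : X → ℕ) (n : ℕ)
    (x : X) : ℝ≥0∞ :=
  info (μ ((fun y (p : ballFin r n) => T.tr p b y) ⁻¹' {fun p : ballFin r n => T.tr p b x}))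

lemma measurable_tr (hb : Measurable b) (g : FG r) : Measurable (T.tr g b) :=
  hb.comp (T.measurable_act _)

lemma measurable_ballInfo (hb : Measurable b) (n : ℕ) : Measurable (ballInfo μ T b n) :=
  measurable_info_cell (measurable_fam (measurable_tr hb) (ballFin r n))

lemma ballInfo_mono (x : X) : Monotone fun n => ballInfo μ T b n x := by
  intro m n hmn
  refine info_cell_le (a := fun y (p : ballFin r n) => T.tr p b y)
    (b := fun y (p : ballFin r m) => T.tr p b y) fun y hy => ?_
  rw [fam_eq_iff (Y := fun g => T.tr g b)] at hy ⊢
  exact fun p hp => hy p (ballFin_mono hmn hp)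

lemma ballInfo_act_le (hT : T.Preserves μ) (hb : Measurable b) (n : ℕ) (g : FG r) (x : X) :
    ballInfo μ T b n (T.act g⁻¹ x) ≤ ballInfo μ T b (wlen g + n) x := by
  have hm := measurable_fam (measurable_tr (T := T) hb) (ballFin r n)
  rw [ballInfo, ← (hT g⁻¹).measure_preimage (hm (measurableSet_singleton _)).nullMeasurableSet]
  refine info_cell_le (a := fun y (p : ballFin r (wlen g + n)) => T.tr p b y)
    (b := fun y (p : ballFin r n) => T.tr p b (T.act g⁻¹ y)) fun y hy => ?_
  rw [fam_eq_iff (Y := fun g => T.tr g b)] at hy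
  refine funext fun p => ?_
  rw [T.tr_act_inv, T.tr_act_inv]
  refine hy _ (mem_ballFin.2 ((wlen_mul_le _ _).trans ?_))
  exact Nat.add_le_add_left (mem_ballFin.1 p.2) _

lemma iSup_ballInfo_act (hT : T.Preserves μ) (hb : Measurable b) (g : FG r) (x : X) :
    ⨆ n, ballInfo μ T b n (T.act g x) = ⨆ n, ballInfo μ T b n x := by
  have key : ∀ (g : FG r) (x : X),
      ⨆ n, ballInfo μ T b n (T.act g⁻¹ x) ≤ ⨆ n, ballInfo μ T b n x := fun g x =>
    iSup_le fun n => (ballInfo_act_le hT hb n g x).trans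
      (le_iSup (fun n => ballInfo μ T b n x) (wlen g + n))
  refine le_antisymm (by simpa using key g⁻¹ x) ?_
  have := key g (T.act g x)
  rwa [← T.act_mul, inv_mul_cancel, T.act_one] at this

/-- If the entropies `H(B_n · b)` are bounded and the action is ergodic, then the cells of `b`
have measure bounded below almost everywhere. -/
lemma ae_info_lt_of_famEnt_le (hT : T.Preserves μ) (herg : T.IsErgodic μ) (hb : Measurable b)
    {M : ℝ≥0∞} (hM : M ≠ ⊤) (hent : ∀ n, famEnt μ (fun g => T.tr g b) (ballFin r n) ≤ M) :
    ∀ᵐ x ∂μ, info (μ (b ⁻¹' {b x})) < M + 1 := by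
  set S : X → ℝ≥0∞ := fun x => ⨆ n, ballInfo μ T b n x with hS
  have hSm : Measurable S := Measurable.iSup fun n => measurable_ballInfo hb n
  have hbad : MeasurableSet {x | M + 1 ≤ S x} := measurableSet_le measurable_const hSm
  have hint : ∫⁻ x, S x ∂μ ≤ M := by
    rw [hS, lintegral_iSup (fun n => measurable_ballInfo hb n)
      (fun m n hmn x => ballInfo_mono x hmn)]
    refine iSup_le fun n => le_trans (le_of_eq ?_) (hent n)
    exact (Hpart_eq_lintegral (measurable_fam (measurable_tr hb) (ballFin r n))).symm
  have hzero : μ {x | M + 1 ≤ S x} = 0 := by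
    refine (herg _ hbad fun g => ?_).resolve_right fun hone => ?_
    · have : T.smulSet g {x | M + 1 ≤ S x} = {x | M + 1 ≤ S x} := by
        ext x
        simp only [BorelAction.smulSet, mem_preimage, mem_ofPred_eq, hS]
        rw [iSup_ballInfo_act hT hb]
      simp [this]
    · have hge := mul_meas_ge_le_lintegral (μ := μ) hSm (M + 1)
      rw [hone, mul_one] at hge
      exact (ENNReal.lt_add_right hM one_ne_zero).not_ge (hge.trans hint)
  have hae : ∀ᵐ x ∂μ, ¬ M + 1 ≤ S x := by
    rw [ae_iff]
    simpa using hzero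
  filter_upwards [hae] with x hx
  refine lt_of_le_of_lt ?_ (not_le.1 hx)
  refine le_trans ?_ (le_iSup (fun n => ballInfo μ T b n x) 0)
  refine info_cell_le (a := fun y (p : ballFin r 0) => T.tr p b y) fun y hy => ?_
  rw [fam_eq_iff (Y := fun g => T.tr g b)] at hy
  have := hy 1 (by simp [ballFin_zero])
  simpa [BorelAction.tr, T.act_one] using this

lemma exp_neg_le_of_info_lt {p : ℝ≥0∞} (hp : p ≠ ⊤) {t : ℝ} (h : info p < ENNReal.ofReal t) :
    Real.exp (-t) ≤ p.toReal := by
  unfold info at h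
  split_ifs at h with h0
  · simp at h
  · have hpos := ENNReal.toReal_pos h0 hp
    replace h := (ENNReal.ofReal_lt_ofReal_iff'.1 h).1
    rw [← Real.le_log_iff_exp_le hpos]
    linarith

end Ergodic

/-- Uniform bound on the number of ergodic components of subgroups
containing a non-trivial normal subgroup. -/
theorem statement2 {r : ℕ} (hr : 1 < r) {X : Type*}
    [mX : MeasurableSpace X] [StandardBorelSpace X]
    (μ : Measure X) [IsProbabilityMeasure μ]
    (T : BorelAction (FG r) X) (hT : T.Preserves μ)
    (herg : T.IsErgodic μ)
    (hdef : ∃ a : X → ℕ, Measurable a ∧ T.Generating a μ ∧ Hpart μ a < ⊤ ∧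
      fInv μ T a ≠ ⊥) :
    ∃ n : ℕ, ∀ Γ : Subgroup (FG r),
      (∃ K : Subgroup (FG r), K.Normal ∧ K ≠ ⊥ ∧ K ≤ Γ) →
      ∀ (k : ℕ) (B : Fin k → Set X),
        (∀ i, MeasurableSet (B i)) → (∀ i, 0 < μ (B i)) →
        (∀ i, ∀ γ ∈ Γ, μ (T.smulSet γ (B i) ∆ B i) = 0) →
        Pairwise (Function.onFun Disjoint B) → k ≤ n := by
  obtain ⟨a, ha, hgen, hfa, hbot⟩ := hdef
  obtain ⟨f, hf⟩ : ∃ f : ℝ, ∀ n, f ≤ fSeq μ T a n := by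
    obtain ⟨f, hf⟩ := EReal.exists_between_coe_real (bot_lt_iff_ne_bot.2 hbot)
    refine ⟨f, fun n => ?_⟩
    exact_mod_cast hf.2.le.trans (iInf_le (fun n => ((fSeq μ T a n : ℝ) : EReal)) n)
  have hr' : (0 : ℝ) < (r : ℝ) - 1 := by
    rw [sub_pos]
    exact_mod_cast hr
  set H : ℝ := (famEnt μ (fun g => T.tr g a) {1}).toReal with hH
  set M : ℝ := -(f - H) / ((r : ℝ) - 1) with hM
  refine ⟨⌊Real.exp (M + 1)⌋₊, ?_⟩
  rintro Γ ⟨K, hK, hK1, hKΓ⟩ k B hB hpos hinv hdisj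
  set b := setPart B
  have hb : Measurable b := measurable_setPart hB
  have hfb : Hpart μ b < ⊤ := Hpart_setPart_lt_top hB
  have hpm := measurable_pairFam (T := T) ha hb
  have hh := isInvSubmod_pairEnt hT ha hb hfa hfb
  have hKb : ∀ g ∈ K, T.tr g b =ᵐ[μ] b := by
    intro g hg
    have hall : ∀ᵐ x ∂μ, ∀ i, T.act g⁻¹ x ∈ B i ↔ x ∈ B i := by
      refine ae_all_iff.2 fun i => ?_
      have := measure_symmDiff_eq_zero_iff.1 (hinv i g (hKΓ hg))
      filter_upwards [this] with x hx
      exact iff_of_eq hx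
    filter_upwards [hall] with x hx
    exact setPart_eq_iff.2 hx
  have hH' : pairEnt μ T a b ({1}, ∅) = H := by
    rw [pairEnt, hH]
    congr 1
    refine le_antisymm (famEnt_le_of_ker (measurable_tr ha) hpm fun x y hxy => ?_)
      (famEnt_le_of_ker hpm (measurable_tr ha) fun x y hxy => (pairFam_ker_iff.1 hxy).1)
    exact pairFam_ker_iff.2 ⟨hxy, by simp⟩
  have hent : ∀ n, pairEnt μ T a b (∅, ballFin r n) ≤ M := by
    refine ent_ballFin_le hr hh.snd hK hK1
      (fun Q R hQR => pairEnt_le_of_normal hT ha hfa hb hfb hK hKb hQR) fun n => ?_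
    rw [latticeF_snd, ← hH']
    refine le_latticeF_snd hr hh (pairEnt_empty ha hb) (fun n => ?_)
      (fun ε hε => exists_pairEnt_sub_le hT ha hgen hfa hB hε) n
    rw [latticeF_pairEnt_ballFin ha hb]
    exact hf n
  have hM0 : 0 ≤ M := ENNReal.toReal_nonneg.trans (hent 0)
  have hfam : ∀ n, famEnt μ (fun g => T.tr g b) (ballFin r n) ≤ ENNReal.ofReal M := by
    intro n
    refine (famEnt_le_of_ker hpm (measurable_tr hb) (P := Finset.disjSum ∅ (ballFin r n))
      fun x y hxy => (pairFam_ker_iff.1 hxy).2).trans ?_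
    exact (ENNReal.le_ofReal_iff_toReal_le (famEnt_lt_top hpm
      (Hpart_pairFam_lt_top hT ha hb hfa hfb) _).ne hM0).2 (hent n)
  have hae := ae_info_lt_of_famEnt_le hT herg hb ENNReal.ofReal_ne_top hfam
  have hlow : ∀ i, Real.exp (-(M + 1)) ≤ μ.real (B i) := by
    intro i
    obtain ⟨x, hxB, hx⟩ : ∃ x ∈ B i, info (μ (b ⁻¹' {b x})) < ENNReal.ofReal M + 1 := by
      by_contra! hcon
      refine (hpos i).ne' (measure_mono_null (fun x hx => ?_) (ae_iff.1 hae))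
      exact not_lt.2 (hcon x hx)
    rw [← ENNReal.ofReal_one, ← ENNReal.ofReal_add hM0 zero_le_one] at hx
    refine (exp_neg_le_of_info_lt (measure_ne_top _ _) hx).trans
      (ENNReal.toReal_mono (measure_ne_top _ _) (measure_mono fun y hy => ?_))
    exact (setPart_eq_iff.1 hy i).2 hxB
  have hsum : ∑ i, μ.real (B i) ≤ 1 := by
    rw [← measureReal_iUnion_fintype hdisj hB]
    exact measureReal_le_one
  have hk : (k : ℝ) * Real.exp (-(M + 1)) ≤ 1 := by
    refine le_trans ?_ hsum
    simpa using Finset.card_nsmul_le_sum Finset.univ (fun i => μ.real (B i)) _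
      fun i _ => hlow i
  refine Nat.le_floor ?_
  rwa [Real.exp_neg, ← div_eq_mul_inv, div_le_one (Real.exp_pos _)] at hk

end FPaper
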